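/- arXiv:1603.07131 — 4 statements merged into one kernel-verified Lean document; each statement's English description precedes it below -/
import Mathlib

section
/- Let E ⊂ ℝ be a closed interval containing 0, let τ₁ < τ₂ be real numbers, and let δ : ℝ × ℝ → ℝ be a C² function such that δ(0, τ) = 0 for all τ ∈ [τ₁, τ₂]. Suppose that for every ε ∈ E, (∂δ/∂ε)(ε, τ₁) < 0 and (∂δ/∂ε)(ε, τ₂) > 0, and that (∂²δ/∂τ∂ε)(ε, τ) > 0 for every ε ∈ E and every τ ∈ (τ₁, τ₂). Then for every ε ∈ E \ {0} there exists a unique τ*(ε) ∈ (τ₁, τ₂) with δ(ε, τ*(ε)) = 0, and moreover (∂δ/∂τ)(ε, τ*(ε)) ≠ 0. -/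
open Filter Topology

theorem mul_pos_of_deriv_pos {a b : ℝ} (ha : a ≤ 0) (hb : 0 ≤ b) {f f' : ℝ → ℝ}
    (hf : ∀ s, HasDerivAt f (f' s) s) (hpos : ∀ s ∈ Set.Icc a b, 0 < f' s) (h0 : f 0 = 0)
    {s : ℝ} (hs : s ∈ Set.Icc a b) (hs0 : s ≠ 0) : 0 < s * f s := by
  have hmono : StrictMonoOn f (Set.Icc a b) := by
    refine strictMonoOn_of_deriv_pos (convex_Icc a b)
      (fun x _ => (hf x).continuousAt.continuousWithinAt) fun x hx => ?_
    rw [(hf x).deriv]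
    exact hpos x (interior_subset hx)
  rcases hs0.lt_or_gt with h | h
  · exact mul_pos_of_neg_of_neg h (h0 ▸ hmono hs ⟨ha, hb⟩ h)
  · exact mul_pos h (h0 ▸ hmono ⟨ha, hb⟩ hs h)

theorem hasDerivAt_prodMk_left {f : ℝ × ℝ → ℝ} (hf : Differentiable ℝ f) (s t : ℝ) :
    HasDerivAt (fun s => f (s, t)) (fderiv ℝ f (s, t) (1, 0)) s :=
  (hf (s, t)).hasFDerivAt.comp_hasDerivAt s ((hasDerivAt_id s).prodMk (hasDerivAt_const s t))

theorem hasDerivAt_prodMk_right {f : ℝ × ℝ → ℝ} (hf : Differentiable ℝ f) (s t : ℝ) :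
    HasDerivAt (fun t => f (s, t)) (fderiv ℝ f (s, t) (0, 1)) t :=
  (hf (s, t)).hasFDerivAt.comp_hasDerivAt t ((hasDerivAt_const t s).prodMk (hasDerivAt_id t))

theorem differentiable_fderiv_apply {f : ℝ × ℝ → ℝ} (hf : ContDiff ℝ 2 f) (v : ℝ × ℝ) :
    Differentiable ℝ fun p => fderiv ℝ f p v :=
  ((hf.fderiv_right (m := 1) (by norm_num)).differentiable (by norm_num)).clm_apply
    (differentiable_const v)

theorem fderiv_fderiv_apply_comm {f : ℝ × ℝ → ℝ} (hf : ContDiff ℝ 2 f) (v w p : ℝ × ℝ) :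
    fderiv ℝ (fun p => fderiv ℝ f p v) p w = fderiv ℝ (fun p => fderiv ℝ f p w) p v := by
  have hd : DifferentiableAt ℝ (fderiv ℝ f) p :=
    (hf.fderiv_right (m := 1) (by norm_num)).differentiable (by norm_num) p
  have key (u : ℝ × ℝ) :
      HasFDerivAt (fun p => fderiv ℝ f p u) ((fderiv ℝ (fderiv ℝ f) p).flip u) p := by
    simpa using hd.hasFDerivAt.clm_apply (hasFDerivAt_const u p)
  rw [(key v).fderiv, (key w).fderiv]
  exact (hf.contDiffAt.isSymmSndFDerivAt (by simp)).eq w v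

/-- Melnikov-type transversal zero finding: if `δ(0, ·) = 0` on `[τ₁, τ₂]`, the `ε`-partial
derivative of `δ` is negative at `τ₁` and positive at `τ₂` for all `ε ∈ E = [a, b]`, and the
mixed second partial `∂²δ/∂τ∂ε` is positive on `E × (τ₁, τ₂)`, then for every nonzero
`ε ∈ E` there is a unique `τ* ∈ (τ₁, τ₂)` with `δ(ε, τ*) = 0`, and at this zero
`∂δ/∂τ (ε, τ*) ≠ 0`. -/
theorem melnikov_transversal_zero
    (a b τ₁ τ₂ : ℝ) (ha : a ≤ 0) (hb : 0 ≤ b) (hτ : τ₁ < τ₂)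
    (δ : ℝ × ℝ → ℝ) (hδ : ContDiff ℝ 2 δ)
    (hzero : ∀ τ ∈ Set.Icc τ₁ τ₂, δ (0, τ) = 0)
    (h1 : ∀ ε ∈ Set.Icc a b, fderiv ℝ δ (ε, τ₁) (1, 0) < 0)
    (h2 : ∀ ε ∈ Set.Icc a b, 0 < fderiv ℝ δ (ε, τ₂) (1, 0))
    (hmixed : ∀ ε ∈ Set.Icc a b, ∀ τ ∈ Set.Ioo τ₁ τ₂,
      0 < fderiv ℝ (fun p : ℝ × ℝ => fderiv ℝ δ p (1, 0)) (ε, τ) (0, 1)) :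
    ∀ ε ∈ Set.Icc a b, ε ≠ 0 →
      ∃ τ ∈ Set.Ioo τ₁ τ₂, δ (ε, τ) = 0 ∧ fderiv ℝ δ (ε, τ) (0, 1) ≠ 0 ∧
        ∀ τ' ∈ Set.Ioo τ₁ τ₂, δ (ε, τ') = 0 → τ' = τ := by
  intro ε hε hε0
  have hd : Differentiable ℝ δ := hδ.differentiable (by norm_num)
  have hslope : ∀ τ ∈ Set.Ioo τ₁ τ₂, 0 < ε * fderiv ℝ δ (ε, τ) (0, 1) := by
    intro τ hτm
    refine mul_pos_of_deriv_pos ha hb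
      (fun s => hasDerivAt_prodMk_left (differentiable_fderiv_apply hδ (0, 1)) s τ)
      (fun s hs => ?_) ?_ hε hε0
    · rw [fderiv_fderiv_apply_comm hδ]
      exact hmixed s hs τ hτm
    · have hev : (fun t => δ (0, t)) =ᶠ[𝓝 τ] fun _ => 0 := by
        filter_upwards [Icc_mem_nhds hτm.1 hτm.2] with t ht using hzero t ht
      exact (hasDerivAt_prodMk_right hd 0 τ).unique
        ((hasDerivAt_const τ (0 : ℝ)).congr_of_eventuallyEq hev)
  have hleft : ε * δ (ε, τ₁) < 0 := by
    have := mul_pos_of_deriv_pos ha hb (fun s => (hasDerivAt_prodMk_left hd s τ₁).neg)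
      (fun s hs => neg_pos.mpr (h1 s hs)) (by simp [hzero τ₁ ⟨le_rfl, hτ.le⟩]) hε hε0
    simpa using this
  have hright : 0 < ε * δ (ε, τ₂) :=
    mul_pos_of_deriv_pos ha hb (fun s => hasDerivAt_prodMk_left hd s τ₂) h2
      (hzero τ₂ ⟨hτ.le, le_rfl⟩) hε hε0
  have hderiv (t : ℝ) :
      HasDerivAt (fun t => ε * δ (ε, t)) (ε * fderiv ℝ δ (ε, t) (0, 1)) t :=
    (hasDerivAt_prodMk_right hd ε t).const_mul ε
  have hcont : ContinuousOn (fun t => ε * δ (ε, t)) (Set.Icc τ₁ τ₂) :=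
    fun t _ => (hderiv t).continuousAt.continuousWithinAt
  have hmono : StrictMonoOn (fun t => ε * δ (ε, t)) (Set.Icc τ₁ τ₂) := by
    refine strictMonoOn_of_deriv_pos (convex_Icc _ _) hcont fun t ht => ?_
    rw [(hderiv t).deriv]
    exact hslope t (by rwa [interior_Icc] at ht)
  obtain ⟨τ, hτm, hτ0⟩ := intermediate_value_Ioo hτ.le hcont ⟨hleft, hright⟩
  refine ⟨τ, hτm, (mul_eq_zero.mp hτ0).resolve_left hε0,
    right_ne_zero_of_mul (hslope τ hτm).ne', fun τ' hτ' h => ?_⟩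
  refine hmono.injOn (Set.Ioo_subset_Icc_self hτ') (Set.Ioo_subset_Icc_self hτm) ?_
  simpa [h] using hτ0.symm
end

section
/- Let u, s ≥ 1, let D ⊆ ℝᵘ × ℝˢ be open, and let F = (F_x, F_y) : D → ℝᵘ × ℝˢ be C². Let ℒ > 0 and let ξ > 0, μ₁, μ₂, C_x, C_y ≥ 0 be constants such that for every z ∈ D: m(∂F_x/∂x(z)) − ℒ‖∂F_x/∂y(z)‖ ≥ ξ; ‖∂F_y/∂y(z)‖ + (1/ℒ)‖∂F_y/∂x(z)‖ ≤ μ₁; ‖∂F_y/∂y(z)‖ + ℒ‖∂F_x/∂y(z)‖ ≤ μ₂; (1/2)‖D²F_x(z)(h,h)‖ ≤ C_x‖h‖² and (1/2)‖D²F_y(z)(h,h)‖ ≤ C_y‖h‖² for all h. Assume μ₁/ξ < 1, μ₂/ξ² < 1, and M > (ℒC_x + C_y)(1 + ℒ²)/(ξ² − μ₂). Then for every z ∈ D and every linear map A₀ : ℝᵘ → ℝˢ with ‖A₀‖ ≤ ℒ, there exist a linear map A₁ with ‖A₁‖ ≤ ℒ and a δ > 0 such that F(J_u(z, A₀, M)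 ∩ B(z, δ)) ⊂ J_u(F(z), A₁, M). -/
open Filter Topology

/-- The minimum expansion `m(B) = inf_{‖z‖=1} ‖B z‖` of a continuous linear map. -/
noncomputable def minExp {E F : Type*} [NormedAddCommGroup E] [NormedSpace ℝ E]
    [NormedAddCommGroup F] [NormedSpace ℝ F] (B : E →L[ℝ] F) : ℝ :=
  ⨅ z : Metric.sphere (0 : E) 1, ‖B (z : E)‖

/-- The quadratic cone `J_u(z, A, M) = { z + (x, Ax + y) : ‖y‖ ≤ M‖x‖² }`. -/
def coneJu {E S : Type*} [NormedAddCommGroup E] [NormedSpace ℝ E]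
    [NormedAddCommGroup S] [NormedSpace ℝ S]
    (z : E × S) (A : E →L[ℝ] S) (M : ℝ) : Set (E × S) :=
  {p | ∃ x : E, ∃ y : S, ‖y‖ ≤ M * ‖x‖ ^ 2 ∧ p = z + (x, A x + y)}

theorem minExp_mul_norm_le {E F : Type*} [NormedAddCommGroup E] [NormedSpace ℝ E]
    [NormedAddCommGroup F] [NormedSpace ℝ F] (B : E →L[ℝ] F) (v : E) :
    minExp B * ‖v‖ ≤ ‖B v‖ := by
  rcases eq_or_ne v 0 with rfl | hv
  · simp
  have hv' : 0 < ‖v‖ := norm_pos_iff.mpr hv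
  have hmem : ‖v‖⁻¹ • v ∈ Metric.sphere (0 : E) 1 := by
    rw [mem_sphere_zero_iff_norm, norm_smul, norm_inv, norm_norm, inv_mul_cancel₀ hv'.ne']
  have hle : minExp B ≤ ‖B (‖v‖⁻¹ • v)‖ :=
    ciInf_le (f := fun z : Metric.sphere (0 : E) 1 => ‖B (z : E)‖)
      ⟨0, by rintro _ ⟨w, rfl⟩; exact norm_nonneg _⟩ ⟨_, hmem⟩
  rw [map_smul, norm_smul, norm_inv, norm_norm, inv_mul_eq_div] at hle
  exact (le_div_iff₀ hv').mp hle

/-- Second-order Taylor estimate along a segment. -/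
theorem norm_taylor_remainder_le {E G : Type*} [NormedAddCommGroup E] [NormedSpace ℝ E]
    [NormedAddCommGroup G] [NormedSpace ℝ G] {f : E → G} {U : Set E} (hU : IsOpen U)
    (hf : ContDiffOn ℝ 2 f U) {z h : E} {K : ℝ}
    (hseg : ∀ t ∈ Set.Icc (0 : ℝ) 1, z + t • h ∈ U)
    (hK : ∀ w ∈ U, (1 / 2) * ‖fderiv ℝ (fderiv ℝ f) w h h‖ ≤ K) :
    ‖f (z + h) - f z - fderiv ℝ f z h‖ ≤ K := by
  have hline : ∀ t : ℝ, HasDerivAt (fun t : ℝ => z + t • h) h t := fun t => by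
    simpa using ((hasDerivAt_id t).smul_const h).const_add z
  have hd1 : ∀ t ∈ Set.Icc (0 : ℝ) 1,
      HasDerivAt (fun t : ℝ => f (z + t • h)) (fderiv ℝ f (z + t • h) h) t := fun t ht =>
    (((hf.contDiffAt (hU.mem_nhds (hseg t ht))).differentiableAt
      (by norm_num)).hasFDerivAt).comp_hasDerivAt t (hline t)
  have hd2 : ∀ t ∈ Set.Icc (0 : ℝ) 1,
      HasDerivAt (fun t : ℝ => fderiv ℝ f (z + t • h) h)
        (fderiv ℝ (fderiv ℝ f) (z + t • h) h h) t := fun t ht => by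
    have hc : ContDiffAt ℝ 1 (fderiv ℝ f) (z + t • h) :=
      (hf.contDiffAt (hU.mem_nhds (hseg t ht))).fderiv_right (by norm_num)
    have := ((hc.differentiableAt (by norm_num)).hasFDerivAt).comp_hasDerivAt t (hline t)
    simpa using this.clm_apply (hasDerivAt_const t h)
  have hb1 : ∀ t ∈ Set.Icc (0 : ℝ) 1,
      ‖fderiv ℝ f (z + t • h) h - fderiv ℝ f z h‖ ≤ 2 * K * t := fun t ht => by
    have := norm_image_sub_le_of_norm_deriv_le_segment'
      (f := fun t : ℝ => fderiv ℝ f (z + t • h) h) (C := 2 * K)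
      (fun x hx => (hd2 x hx).hasDerivWithinAt)
      (fun x hx => by
        have := hK _ (hseg x (Set.Ico_subset_Icc_self hx))
        linarith) t ht
    simpa using this
  have hd3 : ∀ t ∈ Set.Icc (0 : ℝ) 1,
      HasDerivAt (fun t : ℝ => f (z + t • h) - f z - t • fderiv ℝ f z h)
        (fderiv ℝ f (z + t • h) h - fderiv ℝ f z h) t := fun t ht => by
    have := (hasDerivAt_id t).smul_const (fderiv ℝ f z h)
    rw [one_smul] at this
    exact ((hd1 t ht).sub_const (f z)).sub this
  have hB : ∀ t : ℝ, HasDerivAt (fun t : ℝ => K * t ^ 2) (2 * K * t) t := fun t => by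
    have := (hasDerivAt_pow 2 t).const_mul K
    simpa [mul_assoc, mul_left_comm] using this
  have := image_norm_le_of_norm_deriv_right_le_deriv_boundary
    (f := fun t : ℝ => f (z + t • h) - f z - t • fderiv ℝ f z h)
    (fun t ht => (hd3 t ht).continuousAt.continuousWithinAt)
    (fun t ht => (hd3 t (Set.Ico_subset_Icc_self ht)).hasDerivWithinAt)
    (by simp) hB (fun t ht => hb1 t (Set.Ico_subset_Icc_self ht))
    (Set.right_mem_Icc.mpr zero_le_one)
  simpa using this

/-- If an endomorphism `B` of a finite-dimensional space expands norms by a factor at least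
`ξ > 0`, then every map `C` factors as `A ∘ B` with `‖A‖ ≤ ‖C‖ / ξ`. -/
theorem exists_factorization_of_expanding {E S : Type*} [NormedAddCommGroup E] [NormedSpace ℝ E]
    [FiniteDimensional ℝ E] [NormedAddCommGroup S] [NormedSpace ℝ S]
    (B : E →L[ℝ] E) (C : E →L[ℝ] S) {ξ : ℝ} (hξ : 0 < ξ) (hB : ∀ v, ξ * ‖v‖ ≤ ‖B v‖) :
    ∃ A : E →L[ℝ] S, (∀ v, A (B v) = C v) ∧ ‖A‖ ≤ ‖C‖ / ξ := by
  have hinj : Function.Injective (B : E →ₗ[ℝ] E) := by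
    rw [injective_iff_map_eq_zero]
    intro v hv
    have hv' : B v = 0 := hv
    have h := hB v
    rw [hv', norm_zero] at h
    exact norm_le_zero_iff.mp (nonpos_of_mul_nonpos_right h hξ)
  let e := (LinearEquiv.ofInjectiveEndo (B : E →ₗ[ℝ] E) hinj).toContinuousLinearEquiv
  have he : ∀ v, e v = B v := fun v => rfl
  refine ⟨C.comp (e.symm : E →L[ℝ] E), fun v => ?_, ?_⟩
  · rw [← he]
    simp
  · refine ContinuousLinearMap.opNorm_le_bound _ (by positivity) fun w => ?_
    have h1 := hB (e.symm w)
    rw [← he, e.apply_symm_apply] at h1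
    have h2 := C.le_opNorm (e.symm w)
    calc ‖C (e.symm w)‖ ≤ ‖C‖ * ‖e.symm w‖ := h2
      _ ≤ ‖C‖ * (‖w‖ / ξ) := by
        gcongr
        rw [le_div_iff₀ hξ]
        linarith
      _ = ‖C‖ / ξ * ‖w‖ := by ring

/-- Quadratic cone invariance: under the stated expansion/contraction rate conditions and
with `M > (ℒC_x + C_y)(1 + ℒ²)/(ξ² − μ₂)`, the image under `F` of a sufficiently small
piece of the quadratic cone `J_u(z, A₀, M)` is contained in a quadratic cone
`J_u(F(z), A₁, M)` with `‖A₁‖ ≤ ℒ`. -/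
theorem cone_invariance_second_derivative
    {u s : ℕ} (hu : 1 ≤ u) (hs : 1 ≤ s)
    (D : Set (EuclideanSpace ℝ (Fin u) × EuclideanSpace ℝ (Fin s)))
    (hD : IsOpen D)
    (F : EuclideanSpace ℝ (Fin u) × EuclideanSpace ℝ (Fin s) →
      EuclideanSpace ℝ (Fin u) × EuclideanSpace ℝ (Fin s))
    (hF : ContDiffOn ℝ 2 F D)
    (ℒ ξ μ₁ μ₂ Cx Cy M : ℝ)
    (hℒ : 0 < ℒ) (hξ : 0 < ξ) (hμ₁ : 0 ≤ μ₁) (hμ₂ : 0 ≤ μ₂)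
    (hCx : 0 ≤ Cx) (hCy : 0 ≤ Cy)
    (hexp : ∀ z ∈ D,
      ξ ≤ minExp ((fderiv ℝ (fun w => (F w).1) z).comp
            (ContinuousLinearMap.inl ℝ (EuclideanSpace ℝ (Fin u)) (EuclideanSpace ℝ (Fin s))))
          - ℒ * ‖(fderiv ℝ (fun w => (F w).1) z).comp
            (ContinuousLinearMap.inr ℝ (EuclideanSpace ℝ (Fin u)) (EuclideanSpace ℝ (Fin s)))‖)
    (hcon1 : ∀ z ∈ D,
      ‖(fderiv ℝ (fun w => (F w).2) z).comp
          (ContinuousLinearMap.inr ℝ (EuclideanSpace ℝ (Fin u)) (EuclideanSpace ℝ (Fin s)))‖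
        + (1 / ℒ) * ‖(fderiv ℝ (fun w => (F w).2) z).comp
          (ContinuousLinearMap.inl ℝ (EuclideanSpace ℝ (Fin u)) (EuclideanSpace ℝ (Fin s)))‖
        ≤ μ₁)
    (hcon2 : ∀ z ∈ D,
      ‖(fderiv ℝ (fun w => (F w).2) z).comp
          (ContinuousLinearMap.inr ℝ (EuclideanSpace ℝ (Fin u)) (EuclideanSpace ℝ (Fin s)))‖
        + ℒ * ‖(fderiv ℝ (fun w => (F w).1) z).comp
          (ContinuousLinearMap.inr ℝ (EuclideanSpace ℝ (Fin u)) (EuclideanSpace ℝ (Fin s)))‖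
        ≤ μ₂)
    (hCx' : ∀ z ∈ D, ∀ h : EuclideanSpace ℝ (Fin u) × EuclideanSpace ℝ (Fin s),
      (1 / 2) * ‖fderiv ℝ (fun w => fderiv ℝ (fun v => (F v).1) w) z h h‖
        ≤ Cx * (‖h.1‖ ^ 2 + ‖h.2‖ ^ 2))
    (hCy' : ∀ z ∈ D, ∀ h : EuclideanSpace ℝ (Fin u) × EuclideanSpace ℝ (Fin s),
      (1 / 2) * ‖fderiv ℝ (fun w => fderiv ℝ (fun v => (F v).2) w) z h h‖
        ≤ Cy * (‖h.1‖ ^ 2 + ‖h.2‖ ^ 2))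
    (hrate1 : μ₁ / ξ < 1) (hrate2 : μ₂ / ξ ^ 2 < 1)
    (hM : (ℒ * Cx + Cy) * (1 + ℒ ^ 2) / (ξ ^ 2 - μ₂) < M) :
    ∀ z ∈ D, ∀ A₀ : EuclideanSpace ℝ (Fin u) →L[ℝ] EuclideanSpace ℝ (Fin s), ‖A₀‖ ≤ ℒ →
      ∃ A₁ : EuclideanSpace ℝ (Fin u) →L[ℝ] EuclideanSpace ℝ (Fin s), ‖A₁‖ ≤ ℒ ∧
        ∃ δ > 0, F '' (coneJu z A₀ M ∩ Metric.ball z δ) ⊆ coneJu (F z) A₁ M := by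
  intro z hz A₀ hA₀
  have hF1 : ContDiffOn ℝ 2 (fun w => (F w).1) D := hF.fst
  have hF2 : ContDiffOn ℝ 2 (fun w => (F w).2) D := hF.snd
  set f := fun w => (F w).1 with hf
  set g := fun w => (F w).2 with hg
  set fx := (fderiv ℝ f z).comp (ContinuousLinearMap.inl ℝ
    (EuclideanSpace ℝ (Fin u)) (EuclideanSpace ℝ (Fin s))) with hfx
  set fy := (fderiv ℝ f z).comp (ContinuousLinearMap.inr ℝ
    (EuclideanSpace ℝ (Fin u)) (EuclideanSpace ℝ (Fin s))) with hfy
  set gx := (fderiv ℝ g z).comp (ContinuousLinearMap.inl ℝ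
    (EuclideanSpace ℝ (Fin u)) (EuclideanSpace ℝ (Fin s))) with hgx
  set gy := (fderiv ℝ g z).comp (ContinuousLinearMap.inr ℝ
    (EuclideanSpace ℝ (Fin u)) (EuclideanSpace ℝ (Fin s))) with hgy
  have hdf : ∀ a b, fderiv ℝ f z (a, b) = fx a + fy b := fun a b => by
    simp [hfx, hfy, ← map_add]
  have hdg : ∀ a b, fderiv ℝ g z (a, b) = gx a + gy b := fun a b => by
    simp [hgx, hgy, ← map_add]
  have hez := hexp z hz
  have hc1 := hcon1 z hz
  have hc2 := hcon2 z hz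
  have hA₀v : ∀ v, ‖A₀ v‖ ≤ ℒ * ‖v‖ := fun v => A₀.le_of_opNorm_le hA₀ v
  have hBexp : ∀ v, ξ * ‖v‖ ≤ ‖(fx + fy.comp A₀) v‖ := fun v => by
    have h1 := minExp_mul_norm_le fx v
    have h2 : ‖fy (A₀ v)‖ ≤ ‖fy‖ * (ℒ * ‖v‖) :=
      (fy.le_opNorm _).trans (mul_le_mul_of_nonneg_left (hA₀v v) (norm_nonneg _))
    have h3 := norm_sub_le_norm_add (fx v) (fy (A₀ v))
    have h4 := mul_le_mul_of_nonneg_right hez (norm_nonneg v)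
    change _ ≤ ‖fx v + fy (A₀ v)‖
    linarith
  obtain ⟨A₁, hA₁, hA₁n⟩ :=
    exists_factorization_of_expanding (fx + fy.comp A₀) (gx + gy.comp A₀) hξ hBexp
  have hCn : ‖gx + gy.comp A₀‖ ≤ ℒ * μ₁ := by
    calc ‖gx + gy.comp A₀‖ ≤ ‖gx‖ + ‖gy‖ * ‖A₀‖ :=
          (norm_add_le _ _).trans (by gcongr; exact gy.opNorm_comp_le A₀)
      _ ≤ ‖gx‖ + ‖gy‖ * ℒ := by gcongr
      _ = ℒ * (‖gy‖ + 1 / ℒ * ‖gx‖) := by field_simp; ring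
      _ ≤ ℒ * μ₁ := by gcongr
  have hA₁ℒ : ‖A₁‖ ≤ ℒ := by
    refine hA₁n.trans ((div_le_iff₀ hξ).mpr (hCn.trans ?_))
    rw [div_lt_one hξ] at hrate1
    gcongr
  have hgap : 0 < ξ ^ 2 - μ₂ := by
    rw [div_lt_one (by positivity)] at hrate2
    linarith
  have hMpos : 0 < M := lt_of_le_of_lt (by positivity) hM
  rw [div_lt_iff₀ hgap] at hM
  -- Smallness conditions on the radius, all obtained by continuity at `0`.
  have hev1 : ∀ᶠ r : ℝ in 𝓝 0,
      0 < ξ - (‖fy‖ * M + Cx * (1 + (ℒ + M * r) ^ 2)) * r := by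
    refine ContinuousAt.eventually_lt (by fun_prop) (by fun_prop) ?_
    simpa using hξ
  have hev2 : ∀ᶠ r : ℝ in 𝓝 0,
      μ₂ * M + (ℒ * Cx + Cy) * (1 + (ℒ + M * r) ^ 2) <
        M * (ξ - (‖fy‖ * M + Cx * (1 + (ℒ + M * r) ^ 2)) * r) ^ 2 := by
    refine ContinuousAt.eventually_lt (by fun_prop) (by fun_prop) ?_
    simp only [mul_zero, add_zero, sub_zero]
    linarith
  obtain ⟨δ₁, hδ₁, hr⟩ := Metric.eventually_nhds_iff.mp (hev1.and hev2)
  obtain ⟨δ₂, hδ₂, hball⟩ := Metric.isOpen_iff.mp hD z hz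
  refine ⟨A₁, hA₁ℒ, min δ₁ δ₂, lt_min hδ₁ hδ₂, ?_⟩
  rintro _ ⟨_, ⟨⟨x, y, hy, rfl⟩, hxy⟩, rfl⟩
  rw [Metric.mem_ball, dist_self_add_left, lt_min_iff] at hxy
  obtain ⟨hxy₁, hxy₂⟩ := hxy
  have hxδ : ‖x‖ < δ₁ := (norm_fst_le (x, A₀ x + y)).trans_lt hxy₁
  obtain ⟨hr1, hr2⟩ := hr (y := ‖x‖) (by simpa using hxδ)
  have hseg : ∀ t ∈ Set.Icc (0 : ℝ) 1, z + t • (x, A₀ x + y) ∈ D := fun t ht => by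
    apply hball
    rw [Metric.mem_ball, dist_self_add_left, norm_smul, Real.norm_of_nonneg ht.1]
    exact (mul_le_of_le_one_left (norm_nonneg _) ht.2).trans_lt hxy₂
  have hR1 := norm_taylor_remainder_le hD hF1 hseg (fun w hw => hCx' w hw _)
  have hR2 := norm_taylor_remainder_le hD hF2 hseg (fun w hw => hCy' w hw _)
  rw [hdf] at hR1
  rw [hdg] at hR2
  have hx0 := norm_nonneg x
  have hh2 : ‖A₀ x + y‖ ≤ (ℒ + M * ‖x‖) * ‖x‖ := by
    have := norm_add_le (A₀ x) y
    have := hA₀v x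
    linarith
  have hhsq : ‖x‖ ^ 2 + ‖A₀ x + y‖ ^ 2 ≤ (1 + (ℒ + M * ‖x‖) ^ 2) * ‖x‖ ^ 2 := by
    have := pow_le_pow_left₀ (norm_nonneg _) hh2 2
    linarith
  set p := z + (x, A₀ x + y) with hp
  set Rx := f p - f z - (fx x + fy (A₀ x + y)) with hRx
  set Ry := g p - g z - (gx x + gy (A₀ x + y)) with hRy
  replace hR1 : ‖Rx‖ ≤ Cx * ((1 + (ℒ + M * ‖x‖) ^ 2) * ‖x‖ ^ 2) :=
    hR1.trans (mul_le_mul_of_nonneg_left hhsq hCx)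
  replace hR2 : ‖Ry‖ ≤ Cy * ((1 + (ℒ + M * ‖x‖) ^ 2) * ‖x‖ ^ 2) :=
    hR2.trans (mul_le_mul_of_nonneg_left hhsq hCy)
  have hfyy : ‖fy y‖ ≤ ‖fy‖ * (M * ‖x‖ ^ 2) := fy.le_opNorm_of_le hy
  have hgyy : ‖gy y‖ ≤ ‖gy‖ * (M * ‖x‖ ^ 2) := gy.le_opNorm_of_le hy
  have hx1 : f p - f z = (fx + fy.comp A₀) x + (fy y + Rx) := by
    rw [hRx, map_add]
    change _ = fx x + fy (A₀ x) + _
    abel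
  have hy1 : g p - g z - A₁ (f p - f z) = gy y - A₁ (fy y) + (Ry - A₁ Rx) := by
    rw [hx1, map_add A₁, map_add A₁, hA₁, hRy, map_add gy]
    change _ - (gx x + gy (A₀ x) + _) = _
    abel
  have hlow : (ξ - (‖fy‖ * M + Cx * (1 + (ℒ + M * ‖x‖) ^ 2)) * ‖x‖) * ‖x‖ ≤ ‖f p - f z‖ := by
    have h1 := norm_sub_le_norm_add ((fx + fy.comp A₀) x) (fy y + Rx)
    have h2 := norm_add_le (fy y) Rx
    have h3 := hBexp x
    rw [hx1]
    linarith
  have hup : ‖g p - g z - A₁ (f p - f z)‖ ≤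
      (μ₂ * M + (ℒ * Cx + Cy) * (1 + (ℒ + M * ‖x‖) ^ 2)) * ‖x‖ ^ 2 := by
    have h1 := A₁.le_of_opNorm_le hA₁ℒ (fy y)
    have h2 := A₁.le_of_opNorm_le hA₁ℒ Rx
    have h3 := norm_add_le (gy y - A₁ (fy y)) (Ry - A₁ Rx)
    have h4 := norm_sub_le (gy y) (A₁ (fy y))
    have h5 := norm_sub_le Ry (A₁ Rx)
    have h6 := mul_le_mul_of_nonneg_left hfyy hℒ.le
    have h7 := mul_le_mul_of_nonneg_left hR1 hℒ.le
    have h8 := mul_le_mul_of_nonneg_right hc2 (by positivity : 0 ≤ M * ‖x‖ ^ 2)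
    rw [hy1]
    linarith
  refine ⟨f p - f z, g p - g z - A₁ (f p - f z), ?_, ?_⟩
  · calc _ ≤ _ := hup
      _ ≤ M * (ξ - (‖fy‖ * M + Cx * (1 + (ℒ + M * ‖x‖) ^ 2)) * ‖x‖) ^ 2 * ‖x‖ ^ 2 := by
        gcongr
      _ = M * ((ξ - (‖fy‖ * M + Cx * (1 + (ℒ + M * ‖x‖) ^ 2)) * ‖x‖) * ‖x‖) ^ 2 := by ring
      _ ≤ M * ‖f p - f z‖ ^ 2 := by
        gcongr
  · ext1 <;> simp [hf, hg]
end

section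
/- Let u, s ≥ 1 and let f = (f_x, f_y) : ℝᵘ × ℝˢ → ℝᵘ × ℝˢ be a C² vector field whose flow Φ(t, z) is defined for all t ∈ [0, h₀] and all z in a neighborhood of a compact set D ⊆ ℝᵘ × ℝˢ, with Euclidean norms throughout. For M > 0 and h ∈ (0, h₀] define ξ(h, M) := inf_{z∈D} ( m(∂Φ_x/∂x(h,z)) − M‖∂Φ_x/∂y(h,z)‖ ) and ξ⃗(M) := inf_{z∈D} ( m_l(∂f_x/∂x(z)) − M‖∂f_x/∂y(z)‖ ), where m_l(B) is the smallest eigenvalue of (B + Bᵀ)/2. Then there exist C > 0 and h₁ ∈ (0, h₀] such that |ξ(h, M) − 1 − h·ξ⃗(M)| ≤ Ch² for all h ∈ (0, h₁]; in particular ξ(h, M) = 1 + h·ξ⃗(M) + O(h²). -/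
open Filter Topology
open scoped InnerProductSpace

/-- The logarithmic minimum `m_l(B)` of an operator on a Euclidean space: the smallest
eigenvalue of the symmetric part `(B + Bᵀ)/2`, i.e. the infimum of the Rayleigh quotient
`⟪Bv, v⟫` over the unit sphere. -/
noncomputable def rayleighMin {E : Type*} [NormedAddCommGroup E] [InnerProductSpace ℝ E]
    (B : E →L[ℝ] E) : ℝ :=
  ⨅ v : Metric.sphere (0 : E) 1, ⟪B (v : E), (v : E)⟫_ℝ

/-- The block `∂G_x/∂x(z)` of the derivative of a map `G` of a product space. -/
noncomputable def blockXX {E S : Type*} [NormedAddCommGroup E] [NormedSpace ℝ E]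
    [NormedAddCommGroup S] [NormedSpace ℝ S]
    (G : E × S → E × S) (z : E × S) : E →L[ℝ] E :=
  (fderiv ℝ (fun w => (G w).1) z).comp (ContinuousLinearMap.inl ℝ E S)

/-- The block `∂G_x/∂y(z)` of the derivative of a map `G` of a product space. -/
noncomputable def blockXY {E S : Type*} [NormedAddCommGroup E] [NormedSpace ℝ E]
    [NormedAddCommGroup S] [NormedSpace ℝ S]
    (G : E × S → E × S) (z : E × S) : S →L[ℝ] E :=
  (fderiv ℝ (fun w => (G w).1) z).comp (ContinuousLinearMap.inr ℝ E S)

/-- The resolvent of a linear equation `Y' = A(t) Y` exists on `[0, h]` when `2 L h ≤ 1`. -/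
theorem exists_linear_resolvent {E : Type*} [NormedAddCommGroup E] [NormedSpace ℝ E]
    [CompleteSpace E] {A : ℝ → E →L[ℝ] E} {h L : ℝ} (hh : 0 ≤ h) (hL : 0 < L)
    (hLh : 2 * L * h ≤ 1) (hA : ContinuousOn A (Set.Icc 0 h))
    (hAL : ∀ t ∈ Set.Icc 0 h, ‖A t‖ ≤ L) :
    ∃ Y : ℝ → E →L[ℝ] E, Y 0 = 1 ∧
      (∀ t ∈ Set.Icc 0 h, HasDerivWithinAt Y (A t * Y t) (Set.Icc 0 h) t) ∧
      ∀ t ∈ Set.Icc 0 h, ‖Y t - 1‖ ≤ 2 * L * t := by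
  have hPL : IsPicardLindelof (fun t (Y : E →L[ℝ] E) => A t * Y)
      (⟨0, Set.left_mem_Icc.2 hh⟩ : Set.Icc (0 : ℝ) h) 1 1 0 (2 * L.toNNReal) L.toNNReal := by
    refine ⟨fun t ht => ?_, fun Y _ => hA.mul continuousOn_const, fun t ht Y hY => ?_, ?_⟩
    · refine LipschitzOnWith.of_dist_le_mul fun Y _ Z _ => ?_
      rw [dist_eq_norm, dist_eq_norm, ← mul_sub, Real.coe_toNNReal _ hL.le]
      exact (norm_mul_le _ _).trans (by gcongr; exact hAL t ht)
    · have h1 : ‖Y‖ ≤ 2 := by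
        have h2 : ‖Y - 1‖ ≤ 1 := by simpa [dist_eq_norm] using hY
        have h3 : ‖(1 : E →L[ℝ] E)‖ ≤ 1 := ContinuousLinearMap.norm_id_le
        have h4 := norm_add_le (Y - 1) 1
        rw [sub_add_cancel] at h4
        linarith
      have h2 : ‖A t * Y‖ ≤ L * 2 :=
        (norm_mul_le _ _).trans (mul_le_mul (hAL t ht) h1 (norm_nonneg _) hL.le)
      simpa [hL.le, mul_comm] using h2
    · simpa [hL.le, hh] using hLh
  obtain ⟨Y, hY0, hY⟩ := hPL.exists_eq_forall_mem_Icc_hasDerivWithinAt₀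
  refine ⟨Y, hY0, hY, fun t ht => ?_⟩
  have hg := norm_le_gronwallBound_of_norm_deriv_right_le (f := fun t => Y t - 1)
    (f' := fun t => A t * Y t) (δ := 0) (K := L) (ε := L) (a := 0) (b := h)
    (fun t ht => ((hY t ht).continuousWithinAt).sub continuousWithinAt_const)
    (fun t ht => ((hY t (Set.Ico_subset_Icc_self ht)).mono_of_mem_nhdsWithin
      (Icc_mem_nhdsGE_of_mem ht)).sub_const 1) (by simpa [sub_eq_zero] using hY0)
    (fun t ht => by
      have e : A t * Y t = A t * (Y t - 1) + A t := by rw [mul_sub, mul_one]; abel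
      have hAt := hAL t (Set.Ico_subset_Icc_self ht)
      rw [e]
      refine (norm_add_le _ _).trans (add_le_add ((norm_mul_le _ _).trans ?_) hAt)
      gcongr) t ht
  have hLt : L * t ≤ 1 := by nlinarith [mul_le_mul_of_nonneg_left ht.2 hL.le, mul_nonneg hL.le ht.1]
  have he := Real.abs_exp_sub_one_le (x := L * t)
    (by rwa [abs_of_nonneg (mul_nonneg hL.le ht.1)])
  rw [abs_of_nonneg (mul_nonneg hL.le ht.1)] at he
  rw [gronwallBound_of_K_ne_0 hL.ne'] at hg
  simp only [sub_zero, zero_mul, zero_add, div_self hL.ne', one_mul] at hg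
  linarith [le_abs_self (Real.exp (L * t) - 1)]

/-- A flow confined to a convex set on which the vector field has bounded Lipschitz derivative is
differentiable in the initial condition, with derivative `1 + h f'(z) + O(h²)`. -/
theorem exists_hasFDerivAt_flow {E : Type*} [NormedAddCommGroup E] [NormedSpace ℝ E]
    [CompleteSpace E] {f : E → E} {f' : E → E →L[ℝ] E} {S : Set E} {L K N h : ℝ}
    (hS : Convex ℝ S) (hf : ∀ x ∈ S, HasFDerivAt f (f' x) x) (hL : 0 < L) (hK : 0 ≤ K)
    (hfL : ∀ x ∈ S, ‖f' x‖ ≤ L) (hfK : ∀ x ∈ S, ∀ y ∈ S, ‖f' x - f' y‖ ≤ K * ‖x - y‖)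
    (hfN : ∀ x ∈ S, ‖f x‖ ≤ N) (hh : 0 ≤ h) (hLh : 2 * L * h ≤ 1)
    {Φ : ℝ → E → E} {V : Set E} {z : E} (hV : V ∈ 𝓝 z)
    (hΦ0 : ∀ w ∈ V, Φ 0 w = w)
    (hΦ : ∀ w ∈ V, ∀ t ∈ Set.Icc 0 h, HasDerivAt (fun τ => Φ τ w) (f (Φ t w)) t)
    (hΦS : ∀ w ∈ V, ∀ t ∈ Set.Icc 0 h, Φ t w ∈ S) :
    ∃ Y : E →L[ℝ] E, HasFDerivAt (Φ h) Y z ∧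
      ‖Y - 1 - h • f' z‖ ≤ (2 * K * N + 2 * L ^ 2) * h ^ 2 := by
  have hz : z ∈ V := mem_of_mem_nhds hV
  have hcont : ∀ w ∈ V, ContinuousOn (fun τ => Φ τ w) (Set.Icc 0 h) :=
    fun w hw t ht => (hΦ w hw t ht).continuousAt.continuousWithinAt
  have hA : ContinuousOn (fun t => f' (Φ t z)) (Set.Icc 0 h) := by
    have hlip : LipschitzOnWith K.toNNReal f' S :=
      LipschitzOnWith.of_dist_le_mul fun x hx y hy => by
        rw [dist_eq_norm, dist_eq_norm, Real.coe_toNNReal _ hK]; exact hfK x hx y hy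
    exact hlip.continuousOn.comp (hcont z hz) (hΦS z hz)
  obtain ⟨Y, hY0, hY, hY1⟩ := exists_linear_resolvent hh hL hLh hA
    (fun t ht => hfL _ (hΦS z hz t ht))
  have hLt : ∀ t ∈ Set.Icc 0 h, Real.exp (L * t) ≤ 2 := fun t ht => by
    have h0 : 0 ≤ L * t := mul_nonneg hL.le ht.1
    have h1 : L * t ≤ 1 / 2 := by nlinarith [mul_le_mul_of_nonneg_left ht.2 hL.le]
    have he := Real.abs_exp_sub_one_le (x := L * t) (by rw [abs_of_nonneg h0]; linarith)
    rw [abs_of_nonneg h0] at he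
    linarith [le_abs_self (Real.exp (L * t) - 1)]
  have hh' : h ∈ Set.Icc 0 h := Set.right_mem_Icc.2 hh
  refine ⟨Y h, ?_, ?_⟩
  · have hrem : ∀ w ∈ V, ‖Φ h w - Φ h z - Y h (w - z)‖ ≤ 4 * K / L * ‖w - z‖ ^ 2 := by
      intro w hw
      have hdist : ∀ t ∈ Set.Icc 0 h, ‖Φ t w - Φ t z‖ ≤ 2 * ‖w - z‖ := by
        intro t ht
        have hg := norm_le_gronwallBound_of_norm_deriv_right_le (f := fun t => Φ t w - Φ t z)
          (f' := fun t => f (Φ t w) - f (Φ t z)) (δ := ‖w - z‖) (K := L) (ε := 0) (a := 0)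
          (b := h) ((hcont w hw).sub (hcont z hz))
          (fun t ht => ((hΦ w hw t (Set.Ico_subset_Icc_self ht)).sub
            (hΦ z hz t (Set.Ico_subset_Icc_self ht))).hasDerivWithinAt)
          (by rw [hΦ0 w hw, hΦ0 z hz])
          (fun t ht => by
            rw [add_zero]
            exact hS.norm_image_sub_le_of_norm_hasFDerivWithin_le
              (fun x hx => (hf x hx).hasFDerivWithinAt) hfL
              (hΦS z hz t (Set.Ico_subset_Icc_self ht))
              (hΦS w hw t (Set.Ico_subset_Icc_self ht))) t ht
        rw [gronwallBound_ε0, sub_zero] at hg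
        nlinarith [hLt t ht, norm_nonneg (w - z)]
      have hg := norm_le_gronwallBound_of_norm_deriv_right_le
        (f := fun t => Φ t w - Φ t z - Y t (w - z))
        (f' := fun t => f (Φ t w) - f (Φ t z) - f' (Φ t z) (Y t (w - z))) (δ := 0) (K := L)
        (ε := 4 * K * ‖w - z‖ ^ 2) (a := 0) (b := h)
        (((hcont w hw).sub (hcont z hz)).sub
          (fun t ht => ((hY t ht).continuousWithinAt).clm_apply continuousWithinAt_const))
        (fun t ht => by
          have ht' := Set.Ico_subset_Icc_self ht
          refine ((hΦ w hw t ht').sub (hΦ z hz t ht')).hasDerivWithinAt.sub ?_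
          have := ((hY t ht').mono_of_mem_nhdsWithin (Icc_mem_nhdsGE_of_mem ht)).clm_apply
            (hasDerivWithinAt_const t (Set.Ici t) (w - z))
          simpa using this)
        (by simp [hΦ0 w hw, hΦ0 z hz, hY0])
        (fun t ht => by
          have ht' := Set.Ico_subset_Icc_self ht
          have hzS := hΦS z hz t ht'
          have hwS := hΦS w hw t ht'
          have hd := hdist t ht'
          have hseg := hS.segment_subset hzS hwS
          have h1 := Convex.norm_image_sub_le_of_norm_hasFDerivWithin_le' (𝕜 := ℝ)
            (f := f) (φ := f' (Φ t z)) (C := K * ‖Φ t w - Φ t z‖)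
            (fun x hx => (hf x (hseg hx)).hasFDerivWithinAt)
            (fun x hx => (hfK x (hseg hx) _ hzS).trans (by
              gcongr
              have := norm_sub_le_of_mem_segment hx
              simpa [norm_sub_rev] using this))
            (convex_segment _ _) (left_mem_segment ℝ _ _) (right_mem_segment ℝ _ _)
          have e : f (Φ t w) - f (Φ t z) - f' (Φ t z) (Y t (w - z)) =
              f' (Φ t z) (Φ t w - Φ t z - Y t (w - z)) +
              (f (Φ t w) - f (Φ t z) - f' (Φ t z) (Φ t w - Φ t z)) := by
            rw [map_sub _ (Φ t w - Φ t z)]; abel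
          rw [e]
          refine (norm_add_le _ _).trans (add_le_add
            ((f' (Φ t z)).le_of_opNorm_le (hfL _ hzS) _) (h1.trans ?_))
          calc K * ‖Φ t w - Φ t z‖ * ‖Φ t w - Φ t z‖
              ≤ K * (2 * ‖w - z‖) * (2 * ‖w - z‖) := by gcongr
            _ = 4 * K * ‖w - z‖ ^ 2 := by ring) h hh'
      rw [gronwallBound_of_K_ne_0 hL.ne'] at hg
      simp only [sub_zero, zero_mul, zero_add] at hg
      refine hg.trans ?_
      have h0 : 0 ≤ 4 * K * ‖w - z‖ ^ 2 / L := by positivity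
      calc 4 * K * ‖w - z‖ ^ 2 / L * (Real.exp (L * h) - 1)
          ≤ 4 * K * ‖w - z‖ ^ 2 / L * 1 := by
            gcongr; linarith [hLt h hh']
        _ = 4 * K / L * ‖w - z‖ ^ 2 := by ring
    rw [hasFDerivAt_iff_isLittleO]
    refine Asymptotics.IsBigO.trans_isLittleO (g := fun w => ‖w - z‖ ^ 2) ?_
      (Asymptotics.isLittleO_pow_sub_sub z one_lt_two)
    refine Asymptotics.IsBigO.of_bound (4 * K / L) ?_
    filter_upwards [hV] with w hw
    simpa using hrem w hw
  · have hN : 0 ≤ N := (norm_nonneg _).trans (hfN _ (hΦS z hz h hh'))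
    have hm := norm_image_sub_le_of_norm_deriv_le_segment' (f := fun t => Y t - t • f' z)
      (f' := fun t => f' (Φ t z) * Y t - f' z) (a := 0) (b := h)
      (C := (2 * K * N + 2 * L ^ 2) * h)
      (fun t ht => (hY t ht).sub (by
        simpa using ((hasDerivAt_id t).smul_const (f' z)).hasDerivWithinAt))
      (fun t ht => by
        have ht' := Set.Ico_subset_Icc_self ht
        have hzS := hΦS z hz t ht'
        have hz0 : z ∈ S := by
          simpa [hΦ0 z hz] using hΦS z hz 0 (Set.left_mem_Icc.2 hh)
        have hmove := norm_image_sub_le_of_norm_deriv_le_segment' (f := fun τ => Φ τ z)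
          (a := 0) (b := h) (C := N) (fun τ hτ => (hΦ z hz τ hτ).hasDerivWithinAt)
          (fun τ hτ => hfN _ (hΦS z hz τ (Set.Ico_subset_Icc_self hτ))) t ht'
        simp only [hΦ0 z hz, sub_zero] at hmove
        have e : f' (Φ t z) * Y t - f' z =
            f' (Φ t z) * (Y t - 1) + (f' (Φ t z) - f' z) := by
          rw [mul_sub, mul_one]; abel
        rw [e]
        have h1 : ‖f' (Φ t z) * (Y t - 1)‖ ≤ L * (2 * L * t) :=
          (norm_mul_le _ _).trans
            (mul_le_mul (hfL _ hzS) (hY1 t ht') (norm_nonneg _) hL.le)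
        have h2 : ‖f' (Φ t z) - f' z‖ ≤ K * (N * t) :=
          (hfK _ hzS _ hz0).trans (by gcongr)
        calc ‖f' (Φ t z) * (Y t - 1) + (f' (Φ t z) - f' z)‖
            ≤ L * (2 * L * t) + K * (N * t) := (norm_add_le _ _).trans (add_le_add h1 h2)
          _ ≤ L * (2 * L * h) + K * (2 * N * h) := by
            have := ht'.1
            gcongr
            · exact ht'.2
            · linarith
            · exact ht'.2
          _ = (2 * K * N + 2 * L ^ 2) * h := by ring) h hh'
    simp only [hY0, zero_smul, sub_zero] at hm
    calc ‖Y h - 1 - h • f' z‖ = ‖Y h - h • f' z - 1‖ := by congr 1; abel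
      _ ≤ _ := hm
      _ = _ := by ring

theorem abs_ciInf_sub_sub_mul_ciInf_le {ι : Type*} [Nonempty ι] {f g : ι → ℝ} {a h c : ℝ}
    (hh : 0 < h) (hg : BddBelow (Set.range g)) (H : ∀ i, |f i - a - h * g i| ≤ c) :
    |(⨅ i, f i) - a - h * ⨅ i, g i| ≤ c := by
  have lower : ∀ i, a + h * (⨅ i, g i) - c ≤ f i := fun i => by
    have h1 := mul_le_mul_of_nonneg_left (ciInf_le hg i) hh.le
    linarith [(abs_le.1 (H i)).1]
  have hf : BddBelow (Set.range f) := ⟨_, Set.forall_mem_range.2 lower⟩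
  have upper : ((⨅ i, f i) - a - c) / h ≤ ⨅ i, g i := le_ciInf fun i => by
    rw [div_le_iff₀ hh]
    linarith [(abs_le.1 (H i)).2, ciInf_le hf i]
  rw [div_le_iff₀ hh] at upper
  rw [abs_le]
  constructor <;> linarith [le_ciInf lower]

theorem bddBelow_rayleigh {E : Type*} [NormedAddCommGroup E] [InnerProductSpace ℝ E]
    {A : E →L[ℝ] E} {L : ℝ} (hA : ‖A‖ ≤ L) (v : Metric.sphere (0 : E) 1) :
    -L ≤ ⟪A (v : E), (v : E)⟫_ℝ := by
  have hv : ‖(v : E)‖ = 1 := by simp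
  have h1 := abs_real_inner_le_norm (A v) v
  have h2 := A.le_of_opNorm_le hA v
  rw [hv, mul_one] at h1 h2
  linarith [(abs_le.1 h1).1]

/-- The minimum expansion of a perturbation `1 + h A + O(c)` of the identity is
`1 + h m_l(A)` up to `c + ‖A‖² h²`. -/
theorem abs_minExp_sub_one_sub_rayleighMin_le {E : Type*} [NormedAddCommGroup E]
    [InnerProductSpace ℝ E] [Nontrivial E] {A B : E →L[ℝ] E} {L h c : ℝ} (hA : ‖A‖ ≤ L)
    (hh : 0 < h) (hLh : 2 * L * h ≤ 1) (hB : ‖B - 1 - h • A‖ ≤ c) :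
    |minExp B - 1 - h * rayleighMin A| ≤ c + L ^ 2 * h ^ 2 := by
  have : Nonempty (Metric.sphere (0 : E) 1) :=
    (NormedSpace.sphere_nonempty.2 zero_le_one).to_subtype
  refine abs_ciInf_sub_sub_mul_ciInf_le hh
    ⟨-L, Set.forall_mem_range.2 fun v => bddBelow_rayleigh hA v⟩ fun v => ?_
  have hlow := bddBelow_rayleigh hA v
  obtain ⟨v, hv⟩ := v
  replace hv : ‖v‖ = 1 := by simpa using hv
  simp only at hlow ⊢
  have hAv : ‖A v‖ ≤ L := by simpa [hv] using A.le_of_opNorm_le hA v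
  have hBv : ‖B v - (v + h • A v)‖ ≤ c := by
    have := (B - 1 - h • A).le_of_opNorm_le hB v
    simpa [hv, sub_sub] using this
  have h1 : |‖B v‖ - ‖v + h • A v‖| ≤ c := (abs_norm_sub_norm_le _ _).trans hBv
  set q := ⟪A v, v⟫_ℝ
  set r := ‖v + h • A v‖
  have hr : r ^ 2 = 1 + 2 * h * q + h ^ 2 * ‖A v‖ ^ 2 := by
    rw [norm_add_sq_real, hv, inner_smul_right, norm_smul, real_inner_comm, mul_pow,
      Real.norm_eq_abs, sq_abs]
    ring
  have hqr : 1 + h * q ≤ r := by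
    have := real_inner_le_norm (v + h • A v) v
    rw [inner_add_left, inner_smul_left, real_inner_self_eq_norm_sq, hv] at this
    simpa using this
  have hq : 1 / 2 ≤ 1 + h * q := by nlinarith
  have hA2 : ‖A v‖ ^ 2 ≤ L ^ 2 := by gcongr
  have hrq : r - (1 + h * q) ≤ L ^ 2 * h ^ 2 := by
    have e : (r - (1 + h * q)) * (r + (1 + h * q)) = h ^ 2 * (‖A v‖ ^ 2 - q ^ 2) := by
      linear_combination hr
    have h3 : h ^ 2 * (‖A v‖ ^ 2 - q ^ 2) ≤ h ^ 2 * L ^ 2 := by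
      gcongr; nlinarith [sq_nonneg q]
    have h4 : (r - (1 + h * q)) * 1 ≤ (r - (1 + h * q)) * (r + (1 + h * q)) := by
      apply mul_le_mul_of_nonneg_left <;> linarith
    linarith
  rw [abs_le] at h1 ⊢
  constructor <;> nlinarith [sq_nonneg (L * h)]

theorem mem_closedBall_of_flow {E : Type*} [NormedAddCommGroup E] [NormedSpace ℝ E]
    {f : E → E} {x : ℝ → E} {w : E} {N h : ℝ} (hN : 0 ≤ N) (hNh : (N + 1) * h ≤ 1)
    (hf : ∀ y ∈ Metric.closedBall w 1, ‖f y‖ ≤ N) (hx0 : x 0 = w)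
    (hx : ∀ t ∈ Set.Icc 0 h, HasDerivAt x (f (x t)) t) :
    ∀ t ∈ Set.Icc 0 h, x t ∈ Metric.closedBall w 1 := by
  have key : ∀ t ∈ Set.Icc 0 h, (N + 1) * t ≤ 1 := fun t ht => by
    nlinarith [mul_le_mul_of_nonneg_left ht.2 (by linarith : 0 ≤ N + 1)]
  intro t ht
  have hb := image_norm_le_of_norm_deriv_right_lt_deriv_boundary (f := fun t => x t - w)
    (f' := fun t => f (x t)) (a := 0) (b := h) (B := fun t => (N + 1) * t)
    (B' := fun _ => N + 1)
    (fun t ht => ((hx t ht).continuousAt.continuousWithinAt).sub continuousWithinAt_const)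
    (fun t ht => ((hx t (Set.Ico_subset_Icc_self ht)).sub_const w).hasDerivWithinAt)
    (by simp [hx0]) (fun t => by simpa using (hasDerivAt_id t).const_mul (N + 1))
    (fun t ht he => by
      have hm : x t ∈ Metric.closedBall w 1 := by
        rw [mem_closedBall_iff_norm, he]; exact key t (Set.Ico_subset_Icc_self ht)
      linarith [hf _ hm]) ht
  rw [mem_closedBall_iff_norm]
  exact hb.trans (key t ht)

theorem norm_fst_comp_comp_inl_le {E S : Type*} [NormedAddCommGroup E] [NormedSpace ℝ E]
    [NormedAddCommGroup S] [NormedSpace ℝ S] (T : E × S →L[ℝ] E × S) :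
    ‖((ContinuousLinearMap.fst ℝ E S).comp T).comp (ContinuousLinearMap.inl ℝ E S)‖ ≤ ‖T‖ := by
  refine ContinuousLinearMap.opNorm_le_bound _ (norm_nonneg _) fun v => ?_
  have h1 := T.le_opNorm (v, 0)
  rw [Prod.norm_mk v 0, norm_zero, max_eq_left (norm_nonneg _)] at h1
  exact (norm_fst_le _).trans h1

theorem norm_fst_comp_comp_inr_le {E S : Type*} [NormedAddCommGroup E] [NormedSpace ℝ E]
    [NormedAddCommGroup S] [NormedSpace ℝ S] (T : E × S →L[ℝ] E × S) :
    ‖((ContinuousLinearMap.fst ℝ E S).comp T).comp (ContinuousLinearMap.inr ℝ E S)‖ ≤ ‖T‖ := by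
  refine ContinuousLinearMap.opNorm_le_bound _ (norm_nonneg _) fun v => ?_
  have h1 := T.le_opNorm (0, v)
  rw [Prod.norm_mk 0 v, norm_zero, max_eq_right (norm_nonneg _)] at h1
  exact (norm_fst_le _).trans h1

theorem blockXX_eq {E S : Type*} [NormedAddCommGroup E] [NormedSpace ℝ E]
    [NormedAddCommGroup S] [NormedSpace ℝ S] {G : E × S → E × S} {T : E × S →L[ℝ] E × S}
    {z : E × S} (hG : HasFDerivAt G T z) :
    blockXX G z =
      ((ContinuousLinearMap.fst ℝ E S).comp T).comp (ContinuousLinearMap.inl ℝ E S) := by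
  rw [blockXX, hG.fst.fderiv]

theorem blockXY_eq {E S : Type*} [NormedAddCommGroup E] [NormedSpace ℝ E]
    [NormedAddCommGroup S] [NormedSpace ℝ S] {G : E × S → E × S} {T : E × S →L[ℝ] E × S}
    {z : E × S} (hG : HasFDerivAt G T z) :
    blockXY G z =
      ((ContinuousLinearMap.fst ℝ E S).comp T).comp (ContinuousLinearMap.inr ℝ E S) := by
  rw [blockXY, hG.fst.fderiv]

/-- The effect of a first-order expansion `DG(z) = 1 + h Df(z) + O(c)` on the expansion
constants at `z`. -/
theorem abs_expansion_sub_one_sub_le {E S : Type*} [NormedAddCommGroup E]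
    [InnerProductSpace ℝ E] [Nontrivial E] [NormedAddCommGroup S] [NormedSpace ℝ S]
    {G f : E × S → E × S} {T A : E × S →L[ℝ] E × S} {z : E × S} {L M h c : ℝ}
    (hG : HasFDerivAt G T z) (hf : HasFDerivAt f A z) (hA : ‖A‖ ≤ L) (hM : 0 ≤ M)
    (hh : 0 < h) (hLh : 2 * L * h ≤ 1) (hT : ‖T - 1 - h • A‖ ≤ c) :
    |minExp (blockXX G z) - M * ‖blockXY G z‖ - 1
      - h * (rayleighMin (blockXX f z) - M * ‖blockXY f z‖)| ≤ c + L ^ 2 * h ^ 2 + M * c := by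
  have h1 : ‖blockXX G z - 1 - h • blockXX f z‖ ≤ c := by
    refine le_trans (le_of_eq ?_) ((norm_fst_comp_comp_inl_le (T - 1 - h • A)).trans hT)
    rw [blockXX_eq hG, blockXX_eq hf]
    congr 1
  have h2 : ‖blockXY G z - h • blockXY f z‖ ≤ c := by
    refine le_trans (le_of_eq ?_) ((norm_fst_comp_comp_inr_le (T - 1 - h • A)).trans hT)
    rw [blockXY_eq hG, blockXY_eq hf]
    congr 1
    ext v
    simp
  have h3 : ‖blockXX f z‖ ≤ L := by
    rw [blockXX_eq hf]; exact (norm_fst_comp_comp_inl_le A).trans hA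
  have h4 := abs_minExp_sub_one_sub_rayleighMin_le h3 hh hLh h1
  have h5 := (abs_norm_sub_norm_le _ _).trans h2
  rw [norm_smul, Real.norm_of_nonneg hh.le] at h5
  have h6 : |M * (‖blockXY G z‖ - h * ‖blockXY f z‖)| ≤ M * c := by
    rw [abs_mul, abs_of_nonneg hM]; gcongr
  rw [abs_le] at h4 h6 ⊢
  constructor <;> linarith

/-- For a `C²` vector field `f` with flow `Φ` defined on `[0, h₀]` in a neighborhood of a
compact set `D`, the unstable expansion constant `ξ(h, M)` of the time-`h` map satisfies
`ξ(h, M) = 1 + h·ξ⃗(M) + O(h²)`, where `ξ⃗(M)` is the infinitesimal expansion constant of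
the vector field. -/
theorem time_shift_expansion_constant
    {u s : ℕ} (hu : 1 ≤ u) (hs : 1 ≤ s)
    (f : EuclideanSpace ℝ (Fin u) × EuclideanSpace ℝ (Fin s) →
      EuclideanSpace ℝ (Fin u) × EuclideanSpace ℝ (Fin s))
    (hf : ContDiff ℝ 2 f)
    (h₀ : ℝ) (hh₀ : 0 < h₀)
    (D U : Set (EuclideanSpace ℝ (Fin u) × EuclideanSpace ℝ (Fin s)))
    (hD : IsCompact D) (hDne : D.Nonempty) (hU : IsOpen U) (hDU : D ⊆ U)
    (Φ : ℝ → EuclideanSpace ℝ (Fin u) × EuclideanSpace ℝ (Fin s) →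
      EuclideanSpace ℝ (Fin u) × EuclideanSpace ℝ (Fin s))
    (hΦ0 : ∀ z ∈ U, Φ 0 z = z)
    (hΦ : ∀ z ∈ U, ∀ t ∈ Set.Icc (0 : ℝ) h₀,
      HasDerivAt (fun τ => Φ τ z) (f (Φ t z)) t)
    (M : ℝ) (hM : 0 < M) :
    ∃ C > 0, ∃ h₁ ∈ Set.Ioc (0 : ℝ) h₀, ∀ h ∈ Set.Ioc (0 : ℝ) h₁,
      |(⨅ z : D, (minExp (blockXX (Φ h) (z : _)) - M * ‖blockXY (Φ h) (z : _)‖))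
          - 1
          - h * (⨅ z : D, (rayleighMin (blockXX f (z : _)) - M * ‖blockXY f (z : _)‖))|
        ≤ C * h ^ 2 := by
  have : Nonempty (Fin u) := ⟨⟨0, hu⟩⟩
  have hDn : Nonempty D := hDne.to_subtype
  obtain ⟨R, hR⟩ := hD.isBounded.subset_closedBall 0
  have hScomp := isCompact_closedBall
    (0 : EuclideanSpace ℝ (Fin u) × EuclideanSpace ℝ (Fin s)) (R + 2)
  have hSconv := convex_closedBall
    (0 : EuclideanSpace ℝ (Fin u) × EuclideanSpace ℝ (Fin s)) (R + 2)
  set S := Metric.closedBall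
    (0 : EuclideanSpace ℝ (Fin u) × EuclideanSpace ℝ (Fin s)) (R + 2)
  have hdf : Differentiable ℝ f := hf.differentiable (by norm_num)
  have hf1 : ContDiff ℝ 1 (fderiv ℝ f) := hf.fderiv_right (by norm_num)
  obtain ⟨N, hN⟩ := hScomp.exists_bound_of_continuousOn hf.continuous.continuousOn
  obtain ⟨L₀, hL₀⟩ := hScomp.exists_bound_of_continuousOn hf1.continuous.continuousOn
  obtain ⟨K, hK⟩ := hScomp.exists_bound_of_continuousOn
    (hf1.continuous_fderiv (by norm_num)).continuousOn
  have hDS : D ⊆ S := hR.trans (Metric.closedBall_subset_closedBall (by linarith))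
  obtain ⟨z₀, hz₀⟩ := hDne
  have hN0 : 0 ≤ N := (norm_nonneg _).trans (hN z₀ (hDS hz₀))
  have hK0 : 0 ≤ K := (norm_nonneg _).trans (hK z₀ (hDS hz₀))
  have hL₀0 : 0 ≤ L₀ := (norm_nonneg _).trans (hL₀ z₀ (hDS hz₀))
  set L := L₀ + 1
  have hL : 0 < L := by positivity
  have hfL : ∀ x ∈ S, ‖fderiv ℝ f x‖ ≤ L := fun x hx => (hL₀ x hx).trans (by simp [L])
  have hfK : ∀ x ∈ S, ∀ y ∈ S, ‖fderiv ℝ f x - fderiv ℝ f y‖ ≤ K * ‖x - y‖ :=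
    fun x hx y hy => hSconv.norm_image_sub_le_of_norm_fderiv_le
      (fun x _ => hf1.differentiable (by norm_num) x) hK hy hx
  set c := 2 * K * N + 2 * L ^ 2
  refine ⟨c + L ^ 2 + M * c, by positivity, min h₀ (min (1 / (N + 1)) (1 / (2 * L))),
    ⟨by positivity, min_le_left _ _⟩, fun h hh => ?_⟩
  obtain ⟨hpos, hle⟩ := hh
  rw [le_min_iff, le_min_iff, le_div_iff₀ (by positivity), le_div_iff₀ (by positivity)] at hle
  obtain ⟨hh₀', hNh, hLh⟩ := hle
  have hLh' : 2 * L * h ≤ 1 := by linarith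
  refine abs_ciInf_sub_sub_mul_ciInf_le hpos ⟨-L - M * L, ?_⟩ fun z => ?_
  · rintro _ ⟨z, rfl⟩
    have hA := hfL z (hDS z.2)
    have h1 : -L ≤ rayleighMin (blockXX f (z : _)) := by
      have : Nonempty (Metric.sphere (0 : EuclideanSpace ℝ (Fin u)) 1) :=
        (NormedSpace.sphere_nonempty.2 zero_le_one).to_subtype
      refine le_ciInf (bddBelow_rayleigh ?_)
      rw [blockXX_eq (hdf z).hasFDerivAt]
      exact (norm_fst_comp_comp_inl_le _).trans hA
    have h2 : M * ‖blockXY f (z : _)‖ ≤ M * L := by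
      rw [blockXY_eq (hdf z).hasFDerivAt]
      gcongr
      exact (norm_fst_comp_comp_inr_le _).trans hA
    simp only
    linarith
  · obtain ⟨z, hz⟩ := z
    have hsub : Set.Icc 0 h ⊆ Set.Icc 0 h₀ := Set.Icc_subset_Icc_right hh₀'
    have hV : U ∩ Metric.ball 0 (R + 1) ∈ 𝓝 z := by
      refine (hU.inter Metric.isOpen_ball).mem_nhds ⟨hDU hz, ?_⟩
      exact Metric.closedBall_subset_ball (by linarith) (hR hz)
    obtain ⟨Y, hY, hYc⟩ := exists_hasFDerivAt_flow hSconv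
      (fun x _ => (hdf x).hasFDerivAt) hL hK0 hfL hfK hN hpos.le hLh' hV
      (fun w hw => hΦ0 w hw.1) (fun w hw t ht => hΦ w hw.1 t (hsub ht))
      (fun w hw => by
        have hwS : Metric.closedBall w 1 ⊆ S := Metric.closedBall_subset_closedBall' (by
          linarith [Metric.mem_ball.1 hw.2])
        exact fun t ht => hwS (mem_closedBall_of_flow hN0 (by linarith)
          (fun y hy => hN y (hwS hy)) (hΦ0 w hw.1)
          (fun t ht => hΦ w hw.1 t (hsub ht)) t ht))
    refine (abs_expansion_sub_one_sub_le hY (hdf z).hasFDerivAt (hfL z (hDS hz)) hM.le hpos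
      hLh' hYc).trans (le_of_eq ?_)
    ring
end

section
/- Let u, s ≥ 1 and let f = (f_x, f_y) : ℝᵘ × ℝˢ → ℝᵘ × ℝˢ be a C² vector field whose flow Φ(t, z) is defined for all t ∈ [0, h₀] and all z in a neighborhood of a compact set D ⊆ ℝᵘ × ℝˢ, with Euclidean norms throughout. Let M₁, M₂ > 0, j ∈ ℕ, and define μ₂(h, M₁) := sup_{z∈D} ( ‖∂Φ_y/∂y(h,z)‖ + M₁‖∂Φ_x/∂y(h,z)‖ ), ξ(h, M₂) := inf_{z∈D} ( m(∂Φ_x/∂x(h,z)) − M₂‖∂Φ_x/∂y(h,z)‖ ), μ⃗₂(M₁) := sup_{z∈D} ( l(∂f_y/∂y(z)) + M₁‖∂f_x/∂y(z)‖ ), ξ⃗(M₂) := inf_{z∈D} ( m_l(∂f_x/∂x(z)) − M₂‖∂f_x/∂y(z)‖ ), where l(B) and m_l(B) are the largest and smallest eigenvalues of (B + Bᵀ)/2. If μ⃗₂(M₁) < (j+1)·ξ⃗(M₂), then there exists h₁ ∈ (0, h₀] such that for all h ∈ (0, h₁), ξ(h, M₂) > 0 and μ₂(h, M₁)/ξ(h,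 M₂)^{j+1} < 1. -/
open Filter Topology
open scoped InnerProductSpace

/-- The logarithmic norm `l(B)` of an operator on a Euclidean space: the largest eigenvalue
of the symmetric part `(B + Bᵀ)/2`, i.e. the supremum of the Rayleigh quotient `⟪Bv, v⟫`
over the unit sphere. -/
noncomputable def rayleighMax {E : Type*} [NormedAddCommGroup E] [InnerProductSpace ℝ E]
    (B : E →L[ℝ] E) : ℝ :=
  ⨆ v : Metric.sphere (0 : E) 1, ⟪B (v : E), (v : E)⟫_ℝ

/-- The block `∂G_y/∂y(z)` of the derivative of a map `G` of a product space. -/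
noncomputable def blockYY {E S : Type*} [NormedAddCommGroup E] [NormedSpace ℝ E]
    [NormedAddCommGroup S] [NormedSpace ℝ S]
    (G : E × S → E × S) (z : E × S) : S →L[ℝ] S :=
  (fderiv ℝ (fun w => (G w).2) z).comp (ContinuousLinearMap.inr ℝ E S)

section Flow

variable {E : Type*} [NormedAddCommGroup E] [NormedSpace ℝ E]

lemma Real.exp_le_two_of_le_half {x : ℝ} (hx : x ≤ 1 / 2) : Real.exp x ≤ 2 := by
  refine (Real.exp_le_exp.mpr hx).trans ?_
  have h : Real.exp (1 / 2) * Real.exp (1 / 2) = Real.exp 1 := by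
    rw [← Real.exp_add]; norm_num
  nlinarith [Real.exp_one_lt_d9, Real.exp_pos (1 / 2)]

lemma HasDerivWithinAt.Ici_of_Icc {F : Type*} [NormedAddCommGroup F] [NormedSpace ℝ F]
    {g : ℝ → F} {g' : F} {a b t : ℝ} (h : HasDerivWithinAt g g' (Set.Icc a b) t)
    (ht : t ∈ Set.Ico a b) : HasDerivWithinAt g g' (Set.Ici t) t :=
  h.mono_of_mem_nhdsWithin (Icc_mem_nhdsGE_of_mem ht)

/-- The fundamental solution of a linear differential equation on a short time interval. -/
lemma exists_fundamental_solution [CompleteSpace E] {A : ℝ → E →L[ℝ] E} {T L : ℝ}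
    (hT : 0 ≤ T) (hL : 0 ≤ L) (hLT : L * T ≤ 1 / 2) (hA : ContinuousOn A (Set.Icc 0 T))
    (hAL : ∀ t ∈ Set.Icc 0 T, ‖A t‖ ≤ L) :
    ∃ V : ℝ → E →L[ℝ] E, V 0 = 1 ∧
      (∀ t ∈ Set.Icc 0 T, HasDerivWithinAt V ((A t).comp (V t)) (Set.Icc 0 T) t) ∧
      ∀ t ∈ Set.Icc 0 T, ‖V t‖ ≤ 2 := by
  have hone : ‖(1 : E →L[ℝ] E)‖ ≤ 1 := ContinuousLinearMap.norm_id_le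
  have hPL : IsPicardLindelof (fun t (V : E →L[ℝ] E) => (A t).comp V)
      (⟨0, Set.left_mem_Icc.mpr hT⟩ : Set.Icc (0 : ℝ) T) (1 : E →L[ℝ] E)
      1 0 (2 * L.toNNReal) L.toNNReal := by
    refine ⟨fun t ht => ?_, fun V _ => ?_, fun t ht V hV => ?_, ?_⟩
    · refine LipschitzOnWith.of_dist_le_mul fun V _ W _ => ?_
      rw [dist_eq_norm, dist_eq_norm, ← ContinuousLinearMap.comp_sub, Real.coe_toNNReal _ hL]
      exact (ContinuousLinearMap.opNorm_comp_le _ _).trans (by gcongr; exact hAL t ht)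
    · exact hA.clm_comp continuousOn_const
    · have hV2 : ‖V‖ ≤ 2 := by
        have h1 : ‖V - 1‖ ≤ 1 := by simpa [dist_eq_norm] using hV
        have h2 := norm_add_le (V - 1) 1
        rw [sub_add_cancel] at h2
        linarith
      have h3 := (ContinuousLinearMap.opNorm_comp_le (A t) V).trans
        (mul_le_mul (hAL t ht) hV2 (norm_nonneg _) hL)
      simpa [Real.coe_toNNReal _ hL, mul_comm] using h3
    · have h : max (T - 0) (0 - 0) = T := by simpa using hT
      simp only [NNReal.coe_mul, NNReal.coe_ofNat, Real.coe_toNNReal _ hL, NNReal.coe_one,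
        NNReal.coe_zero, h]
      linarith
  obtain ⟨V, hV0, hV⟩ := hPL.exists_eq_forall_mem_Icc_hasDerivWithinAt₀
  refine ⟨V, hV0, hV, fun t ht => ?_⟩
  have hb := norm_le_gronwallBound_of_norm_deriv_right_le (δ := 1) (K := L) (ε := 0)
    (fun t ht => (hV t ht).continuousWithinAt)
    (fun t ht => (hV t (Set.Ico_subset_Icc_self ht)).Ici_of_Icc ht)
    (by simpa only [hV0] using hone)
    (fun t ht => by
      rw [add_zero]
      refine (ContinuousLinearMap.opNorm_comp_le _ _).trans ?_
      gcongr
      exact hAL t (Set.Ico_subset_Icc_self ht)) t ht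
  rw [gronwallBound_ε0, one_mul, sub_zero] at hb
  exact hb.trans (Real.exp_le_two_of_le_half
    ((mul_le_mul_of_nonneg_left ht.2 hL).trans hLT))

/-- An integral curve starting in `closedBall z (r / 2)` stays in `closedBall z r` for a time
controlled by a bound on the vector field. -/
lemma integralCurve_mem_closedBall {f : E → E} {γ : ℝ → E} {z : E} {r C T : ℝ}
    (hC : 0 ≤ C) (hCT : (C + 1) * T ≤ r / 2) (hfC : ∀ x ∈ Metric.closedBall z r, ‖f x‖ ≤ C)
    (hγ0 : γ 0 ∈ Metric.closedBall z (r / 2))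
    (hγ : ∀ t ∈ Set.Icc 0 T, HasDerivAt γ (f (γ t)) t) :
    ∀ t ∈ Set.Icc 0 T, γ t ∈ Metric.closedBall z r := by
  have key : ∀ t ∈ Set.Icc 0 T, ‖γ t - γ 0‖ ≤ (C + 1) * t → γ t ∈ Metric.closedBall z r := by
    intro t ht h
    have h2 : (C + 1) * t ≤ (C + 1) * T := by gcongr; exact ht.2
    rw [Metric.mem_closedBall] at hγ0 ⊢
    have := dist_triangle (γ t) (γ 0) z
    rw [dist_eq_norm (γ t) (γ 0)] at this
    linarith
  intro t ht
  refine key t ht ?_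
  refine image_norm_le_of_norm_deriv_right_lt_deriv_boundary
    (f := fun t => γ t - γ 0) (f' := fun t => f (γ t)) (B := fun t => (C + 1) * t)
    (B' := fun _ => C + 1) (a := 0) (b := T)
    (fun t ht => ((hγ t ht).continuousAt.sub continuousAt_const).continuousWithinAt)
    (fun t ht => ((hγ t (Set.Ico_subset_Icc_self ht)).sub_const _).hasDerivWithinAt)
    (by simp) (fun t => by simpa using (hasDerivAt_id t).const_mul (C + 1)) ?_ ht
  intro t ht h
  linarith [hfC _ (key t (Set.Ico_subset_Icc_self ht) h.le)]

/-- Near a point `z`, the time-`t` map of a flow is differentiable at `z`, and its derivative is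
the identity plus `t` times the derivative of the vector field, up to an error `O(ε t)` where `ε`
controls the oscillation of the derivative of the field. -/
lemma exists_hasFDerivAt_flow_s16 [ProperSpace E] {f : E → E}
    (hf : ContDiff ℝ 1 f) {Φ : ℝ → E → E} {z : E} {r C L T ε : ℝ}
    (hr : 0 < r) (hC : 0 ≤ C) (hL : 1 ≤ L) (hT : 0 ≤ T)
    (hCT : (C + 1) * T ≤ r / 2) (hLT : L * T ≤ 1 / 2) (hLε : L ^ 2 * T ≤ ε)
    (hfC : ∀ x ∈ Metric.closedBall z r, ‖f x‖ ≤ C)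
    (hfL : ∀ x ∈ Metric.closedBall z r, ‖fderiv ℝ f x‖ ≤ L)
    (hfε : ∀ x ∈ Metric.closedBall z r, ‖fderiv ℝ f x - fderiv ℝ f z‖ ≤ ε)
    (hΦ0 : ∀ w ∈ Metric.closedBall z (r / 2), Φ 0 w = w)
    (hΦ : ∀ w ∈ Metric.closedBall z (r / 2), ∀ t ∈ Set.Icc 0 T,
      HasDerivAt (fun τ => Φ τ w) (f (Φ t w)) t) :
    ∀ t ∈ Set.Icc 0 T, ∃ V : E →L[ℝ] E, HasFDerivAt (Φ t) V z ∧
      ‖V - 1 - t • fderiv ℝ f z‖ ≤ 4 * ε * t := by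
  have hdiff : Differentiable ℝ f := hf.differentiable (by norm_num)
  have hcf : Continuous (fderiv ℝ f) := hf.continuous_fderiv (by norm_num)
  have hL0 : 0 ≤ L := by linarith
  have hε0 : 0 ≤ ε := (by positivity : 0 ≤ L ^ 2 * T).trans hLε
  have hz : z ∈ Metric.closedBall z (r / 2) := Metric.mem_closedBall_self (by positivity)
  have hzr : z ∈ Metric.closedBall z r := Metric.mem_closedBall_self hr.le
  have hmem : ∀ w ∈ Metric.closedBall z (r / 2), ∀ t ∈ Set.Icc 0 T,
      Φ t w ∈ Metric.closedBall z r := fun w hw =>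
    integralCurve_mem_closedBall hC hCT hfC (by rwa [hΦ0 w hw]) (hΦ w hw)
  obtain ⟨V, hV0, hV, hV2⟩ := exists_fundamental_solution (A := fun t => fderiv ℝ f (Φ t z))
    hT hL0 hLT
    (hcf.comp_continuousOn fun t ht => (hΦ z hz t ht).continuousAt.continuousWithinAt)
    (fun t ht => hfL _ (hmem z hz t ht))
  have hVcont : ContinuousOn V (Set.Icc 0 T) := fun t ht => (hV t ht).continuousWithinAt
  have hV1 : ∀ t ∈ Set.Icc 0 T, ‖V t - 1‖ ≤ 2 * L * t := by
    have h := norm_image_sub_le_of_norm_deriv_right_le_segment (C := 2 * L) hVcont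
      (fun t ht => (hV t (Set.Ico_subset_Icc_self ht)).Ici_of_Icc ht) (fun t ht => by
        have ht' := Set.Ico_subset_Icc_self ht
        have := (ContinuousLinearMap.opNorm_comp_le (fderiv ℝ f (Φ t z)) (V t)).trans
          (mul_le_mul (hfL _ (hmem z hz t ht')) (hV2 t ht') (norm_nonneg _) hL0)
        linarith)
    simpa [hV0] using h
  intro t ht
  refine ⟨V t, ?_, ?_⟩
  · have hlip : ∀ w ∈ Metric.closedBall z (r / 2), ∀ t ∈ Set.Icc 0 T,
        dist (Φ t w) (Φ t z) ≤ 2 * dist w z := by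
      intro w hw t ht
      have hlipf : LipschitzOnWith L.toNNReal f (Metric.closedBall z r) :=
        (convex_closedBall z r).lipschitzOnWith_of_nnnorm_fderiv_le (fun x _ => hdiff x)
          (fun x hx => by
            rw [← NNReal.coe_le_coe, Real.coe_toNNReal _ hL0]
            exact hfL x hx)
      have h := dist_le_of_trajectories_ODE_of_mem (v := fun _ => f)
        (s := fun _ => Metric.closedBall z r) (fun _ _ => hlipf)
        (fun t ht => (hΦ w hw t ht).continuousAt.continuousWithinAt)
        (fun t ht => (hΦ w hw t (Set.Ico_subset_Icc_self ht)).hasDerivWithinAt)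
        (fun t ht => hmem w hw t (Set.Ico_subset_Icc_self ht))
        (fun t ht => (hΦ z hz t ht).continuousAt.continuousWithinAt)
        (fun t ht => (hΦ z hz t (Set.Ico_subset_Icc_self ht)).hasDerivWithinAt)
        (fun t ht => hmem z hz t (Set.Ico_subset_Icc_self ht))
        (δ := dist w z) (by rw [hΦ0 w hw, hΦ0 z hz]) t ht
      rw [Real.coe_toNNReal _ hL0, sub_zero] at h
      have h2 := Real.exp_le_two_of_le_half
        ((mul_le_mul_of_nonneg_left ht.2 hL0).trans hLT)
      nlinarith [dist_nonneg (x := w) (y := z)]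
    rw [hasFDerivAt_iff_isLittleO, Asymptotics.isLittleO_iff]
    intro c hc
    have hunif := (isCompact_closedBall z r).uniformContinuousOn_of_continuous hcf.continuousOn
    obtain ⟨η, hη, hηc⟩ := Metric.uniformContinuousOn_iff.mp hunif (c / 2) (by positivity)
    filter_upwards [Metric.ball_mem_nhds z (show 0 < min (r / 2) (η / 2) by positivity)]
      with w hw
    rw [Metric.mem_ball, lt_min_iff] at hw
    have hwr : w ∈ Metric.closedBall z (r / 2) := Metric.mem_closedBall.mpr hw.1.le
    have hg := norm_le_gronwallBound_of_norm_deriv_right_le (δ := 0) (K := L)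
      (ε := c / 2 * (2 * dist w z)) (f := fun t => Φ t w - Φ t z - V t (w - z))
      (f' := fun t => f (Φ t w) - f (Φ t z) - (fderiv ℝ f (Φ t z)).comp (V t) (w - z))
      (a := 0) (b := T)
      (((HasDerivAt.continuousOn fun t ht => hΦ w hwr t ht).sub
        (HasDerivAt.continuousOn fun t ht => hΦ z hz t ht)).sub
        (hVcont.clm_apply continuousOn_const))
      (fun t ht => by
        have ht' := Set.Ico_subset_Icc_self ht
        have h3 := (((hV t ht').Ici_of_Icc ht).clm_apply
          (hasDerivWithinAt_const t (Set.Ici t) (w - z)))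
        simp only [map_zero, add_zero] at h3
        exact ((hΦ w hwr t ht').hasDerivWithinAt.sub (hΦ z hz t ht').hasDerivWithinAt).sub h3)
      (by simp [hΦ0 w hwr, hΦ0 z hz, hV0])
      (fun t ht => by
        have ht' := Set.Ico_subset_Icc_self ht
        have hd := hlip w hwr t ht'
        have hmv := ((convex_closedBall z r).inter
          (convex_ball (Φ t z) η)).norm_image_sub_le_of_norm_fderiv_le' (f := f)
          (φ := fderiv ℝ f (Φ t z)) (C := c / 2) (fun x _ => hdiff x)
          (fun x hx => by
            rw [← dist_eq_norm]
            exact (hηc x hx.1 _ (hmem z hz t ht') hx.2).le)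
          ⟨hmem z hz t ht', Metric.mem_ball_self hη⟩
          ⟨hmem w hwr t ht', Metric.mem_ball.mpr (by linarith)⟩
        have hsplit : f (Φ t w) - f (Φ t z) - (fderiv ℝ f (Φ t z)).comp (V t) (w - z) =
            fderiv ℝ f (Φ t z) (Φ t w - Φ t z - V t (w - z)) +
            (f (Φ t w) - f (Φ t z) - fderiv ℝ f (Φ t z) (Φ t w - Φ t z)) := by
          simp only [map_sub, ContinuousLinearMap.comp_apply]
          abel
        rw [hsplit]
        refine (norm_add_le _ _).trans (add_le_add ?_ ?_)
        · exact (ContinuousLinearMap.le_opNorm _ _).trans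
            (by gcongr; exact hfL _ (hmem z hz t ht'))
        · refine hmv.trans ?_
          rw [← dist_eq_norm]
          gcongr) t ht
    refine hg.trans ?_
    have hexp := Real.exp_le_two_of_le_half
      ((mul_le_mul_of_nonneg_left ht.2 hL0).trans hLT)
    rw [gronwallBound_of_K_ne_0 (by positivity), sub_zero, ← dist_eq_norm]
    simp only [zero_mul, zero_add]
    have h1 : c / 2 * (2 * dist w z) / L ≤ c * dist w z := by
      rw [div_le_iff₀ (by positivity)]
      nlinarith [mul_nonneg hc.le (dist_nonneg (x := w) (y := z))]
    have h2 : 0 ≤ c / 2 * (2 * dist w z) / L := by positivity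
    nlinarith [Real.add_one_le_exp (L * t), mul_nonneg hL0 ht.1]
  · have hder : ∀ t ∈ Set.Ico 0 T, HasDerivWithinAt (fun t => V t - 1 - t • fderiv ℝ f z)
        ((fderiv ℝ f (Φ t z)).comp (V t) - fderiv ℝ f z) (Set.Ici t) t := fun t ht => by
      have h := (hasDerivAt_id t).smul_const (fderiv ℝ f z)
      rw [one_smul] at h
      exact (((hV t (Set.Ico_subset_Icc_self ht)).Ici_of_Icc ht).sub_const 1).sub
        h.hasDerivWithinAt
    have h := norm_image_sub_le_of_norm_deriv_right_le_segment (C := 4 * ε)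
      ((hVcont.sub continuousOn_const).sub (by fun_prop)) hder (fun t ht => by
        have ht' := Set.Ico_subset_Icc_self ht
        have hsplit : (fderiv ℝ f (Φ t z)).comp (V t) - fderiv ℝ f z =
            (fderiv ℝ f (Φ t z) - fderiv ℝ f z).comp (V t) +
              (fderiv ℝ f z).comp (V t - 1) := by
          ext x
          simp
        rw [hsplit]
        have h1 := (ContinuousLinearMap.opNorm_comp_le (fderiv ℝ f (Φ t z) - fderiv ℝ f z)
          (V t)).trans (mul_le_mul (hfε _ (hmem z hz t ht')) (hV2 t ht') (norm_nonneg _) hε0)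
        have h2 := (ContinuousLinearMap.opNorm_comp_le (fderiv ℝ f z) (V t - 1)).trans
          (mul_le_mul (hfL _ hzr) (hV1 t ht') (norm_nonneg _) hL0)
        have h3 : L ^ 2 * t ≤ L ^ 2 * T := by gcongr; exact ht.2.le
        refine (norm_add_le _ _).trans ?_
        nlinarith) t ht
    simpa [hV0] using h

/-- The time-`h` map of the flow of a `C¹` vector field expands to first order,
`DΦ_h = 1 + h Df + o(h)`, uniformly on compact sets. -/
lemma exists_hasFDerivAt_flow_uniform [ProperSpace E] {f : E → E}
    (hf : ContDiff ℝ 1 f) {Φ : ℝ → E → E} {D U : Set E} {h₀ : ℝ} (hh₀ : 0 < h₀)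
    (hD : IsCompact D) (hU : IsOpen U) (hDU : D ⊆ U) (hΦ0 : ∀ z ∈ U, Φ 0 z = z)
    (hΦ : ∀ z ∈ U, ∀ t ∈ Set.Icc (0 : ℝ) h₀, HasDerivAt (fun τ => Φ τ z) (f (Φ t z)) t)
    {ε : ℝ} (hε : 0 < ε) :
    ∃ T ∈ Set.Ioc 0 h₀, ∀ h ∈ Set.Icc 0 T, ∀ z ∈ D,
      ∃ V : E →L[ℝ] E, HasFDerivAt (Φ h) V z ∧ ‖V - 1 - h • fderiv ℝ f z‖ ≤ ε * h := by
  have hcf : Continuous (fderiv ℝ f) := hf.continuous_fderiv (by norm_num)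
  obtain ⟨r₁, hr₁, hr₁U⟩ := hD.exists_cthickening_subset_open hU hDU
  have hK : IsCompact (Metric.cthickening r₁ D) := hD.cthickening
  obtain ⟨C, hC⟩ := hK.exists_bound_of_continuousOn hf.continuous.continuousOn
  obtain ⟨L, hL⟩ := hK.exists_bound_of_continuousOn hcf.continuousOn
  obtain ⟨η, hη, hηε⟩ := Metric.uniformContinuousOn_iff.mp
    (hK.uniformContinuousOn_of_continuous hcf.continuousOn) (ε / 4) (by positivity)
  set r := min r₁ (η / 2) with hr_def
  have hr : 0 < r := by positivity
  have hC1 : 0 < |C| + 1 := by positivity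
  have hL1 : 0 < |L| + 1 := by positivity
  set T := min h₀ (min (r / 2 / (|C| + 1)) (min (1 / 2 / (|L| + 1))
    (ε / 4 / (|L| + 1) ^ 2))) with hT_def
  have hT : 0 < T := by positivity
  have hT1 : T ≤ h₀ := min_le_left _ _
  have hT2 : (|C| + 1) * T ≤ r / 2 := by
    rw [← le_div_iff₀' hC1]
    exact (min_le_right _ _).trans (min_le_left _ _)
  have hT3 : (|L| + 1) * T ≤ 1 / 2 := by
    rw [← le_div_iff₀' hL1]
    exact (min_le_right _ _).trans ((min_le_right _ _).trans (min_le_left _ _))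
  have hT4 : (|L| + 1) ^ 2 * T ≤ ε / 4 := by
    rw [← le_div_iff₀' (by positivity)]
    exact (min_le_right _ _).trans ((min_le_right _ _).trans (min_le_right _ _))
  refine ⟨T, ⟨hT, hT1⟩, fun h hh z hz => ?_⟩
  have hball : ∀ x ∈ Metric.closedBall z r, x ∈ Metric.cthickening r₁ D := fun x hx =>
    Metric.closedBall_subset_cthickening hz r₁
      (Metric.closedBall_subset_closedBall (min_le_left _ _) hx)
  have hhalf : ∀ x ∈ Metric.closedBall z (r / 2), x ∈ U := fun x hx =>
    hr₁U (hball x (Metric.closedBall_subset_closedBall (by linarith) hx))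
  obtain ⟨V, hV, hVε⟩ := exists_hasFDerivAt_flow_s16 hf (Φ := Φ) (z := z) (ε := ε / 4) hr
    (abs_nonneg C) (le_add_of_nonneg_left (abs_nonneg L)) hT.le hT2 hT3 hT4
    (fun x hx => (hC x (hball x hx)).trans (le_abs_self C))
    (fun x hx => (hL x (hball x hx)).trans ((le_abs_self L).trans (by linarith)))
    (fun x hx => by
      rw [← dist_eq_norm]
      refine (hηε x (hball x hx) z (Metric.self_subset_cthickening D hz) ?_).le
      exact (Metric.mem_closedBall.mp hx).trans_lt
        ((min_le_right _ _).trans_lt (by linarith)))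
    (fun w hw => hΦ0 w (hhalf w hw))
    (fun w hw t ht => hΦ w (hhalf w hw) t ⟨ht.1, ht.2.trans hT1⟩) h hh
  exact ⟨V, hV, hVε.trans_eq (by ring)⟩

end Flow

section Rayleigh

variable {E : Type*} [NormedAddCommGroup E] [InnerProductSpace ℝ E]

lemma abs_inner_apply_self_le (B : E →L[ℝ] E) (v : Metric.sphere (0 : E) 1) :
    |⟪B (v : E), (v : E)⟫_ℝ| ≤ ‖B‖ := by
  have hv : ‖(v : E)‖ = 1 := by simp
  have h1 := abs_real_inner_le_norm (B (v : E)) (v : E)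
  have h2 := B.le_opNorm (v : E)
  rw [hv, mul_one] at h1 h2
  exact h1.trans h2

lemma inner_apply_self_le_rayleighMax (B : E →L[ℝ] E) (v : Metric.sphere (0 : E) 1) :
    ⟪B (v : E), (v : E)⟫_ℝ ≤ rayleighMax B :=
  le_ciSup (f := fun v : Metric.sphere (0 : E) 1 => ⟪B (v : E), (v : E)⟫_ℝ)
    ⟨‖B‖, by rintro _ ⟨w, rfl⟩; exact (abs_le.mp (abs_inner_apply_self_le B w)).2⟩ v

lemma rayleighMin_le_inner_apply_self (B : E →L[ℝ] E) (v : Metric.sphere (0 : E) 1) :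
    rayleighMin B ≤ ⟪B (v : E), (v : E)⟫_ℝ :=
  ciInf_le (f := fun v : Metric.sphere (0 : E) 1 => ⟪B (v : E), (v : E)⟫_ℝ)
    ⟨-‖B‖, by rintro _ ⟨w, rfl⟩; exact (abs_le.mp (abs_inner_apply_self_le B w)).1⟩ v

lemma rayleighMax_le_norm [Nontrivial E] (B : E →L[ℝ] E) : rayleighMax B ≤ ‖B‖ :=
  have : Nonempty (Metric.sphere (0 : E) 1) :=
    (NormedSpace.sphere_nonempty.mpr zero_le_one).to_subtype
  ciSup_le fun v => (abs_le.mp (abs_inner_apply_self_le B v)).2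

lemma neg_norm_le_rayleighMin [Nontrivial E] (B : E →L[ℝ] E) : -‖B‖ ≤ rayleighMin B :=
  have : Nonempty (Metric.sphere (0 : E) 1) :=
    (NormedSpace.sphere_nonempty.mpr zero_le_one).to_subtype
  le_ciInf fun v => (abs_le.mp (abs_inner_apply_self_le B v)).1

lemma norm_one_add_smul_le [Nontrivial E] (B : E →L[ℝ] E) {h : ℝ} (hh : 0 ≤ h) :
    ‖1 + h • B‖ ≤ 1 + h * rayleighMax B + (h * ‖B‖) ^ 2 := by
  have hunit : ∀ v : E, ‖v‖ = 1 →
      ‖(1 + h • B) v‖ ≤ 1 + h * rayleighMax B + (h * ‖B‖) ^ 2 := by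
    intro v hv
    have h1 := mul_le_mul_of_nonneg_left
      (inner_apply_self_le_rayleighMax B ⟨v, by simpa using hv⟩) hh
    have h2 : ‖h • B v‖ ≤ h * ‖B‖ := by
      rw [norm_smul, Real.norm_of_nonneg hh]
      gcongr
      simpa [hv] using B.le_opNorm v
    have h3 := norm_add_sq_real v (h • B v)
    rw [hv, real_inner_comm, real_inner_smul_left] at h3
    have h4 : ‖h • B v‖ ^ 2 ≤ (h * ‖B‖) ^ 2 := by gcongr
    have h5 : (1 + h • B) v = v + h • B v := rfl
    rw [h5]
    dsimp only at h1
    nlinarith [sq_nonneg (‖v + h • B v‖ - 1), sq_nonneg (h * ‖B‖)]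
  obtain ⟨v, hv⟩ := NormedSpace.sphere_nonempty (E := E) (x := 0) (r := 1) |>.mpr zero_le_one
  exact ContinuousLinearMap.opNorm_le_of_unit_norm
    ((norm_nonneg _).trans (hunit v (by simpa using hv))) hunit

lemma le_minExp_of_norm_sub_le [Nontrivial E] (B P : E →L[ℝ] E) {h δ : ℝ} (hh : 0 ≤ h)
    (hP : ‖P - (1 + h • B)‖ ≤ δ) : 1 + h * rayleighMin B - δ ≤ minExp P := by
  have : Nonempty (Metric.sphere (0 : E) 1) :=
    (NormedSpace.sphere_nonempty.mpr zero_le_one).to_subtype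
  refine le_ciInf fun v => ?_
  have hv : ‖(v : E)‖ = 1 := by simp
  have h1 := mul_le_mul_of_nonneg_left (rayleighMin_le_inner_apply_self B v) hh
  have h2 : 1 + h * ⟪B (v : E), (v : E)⟫_ℝ ≤ ‖(1 + h • B) (v : E)‖ := by
    have h3 := real_inner_le_norm ((1 + h • B) (v : E)) (v : E)
    have h4 : (1 + h • B) (v : E) = (v : E) + h • B (v : E) := rfl
    rw [hv, mul_one] at h3
    refine le_trans (le_of_eq ?_) h3
    rw [h4, inner_add_left, real_inner_smul_left, real_inner_self_eq_norm_sq, hv, one_pow]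
  have h5 := (P - (1 + h • B)).le_opNorm (v : E)
  rw [hv, mul_one, sub_apply] at h5
  have h6 := norm_sub_norm_le ((1 + h • B) (v : E)) (P (v : E))
  rw [norm_sub_rev] at h6
  linarith

end Rayleigh

section Blocks

open ContinuousLinearMap

variable {E S : Type*} [NormedAddCommGroup E] [NormedSpace ℝ E]
  [NormedAddCommGroup S] [NormedSpace ℝ S]

lemma norm_fst_comp_comp_inl_le_s16 (R : E × S →L[ℝ] E × S) :
    ‖((fst ℝ E S).comp R).comp (inl ℝ E S)‖ ≤ ‖R‖ :=
  opNorm_le_bound _ (norm_nonneg R) fun x =>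
    (norm_fst_le (R (x, 0))).trans ((R.le_opNorm _).trans_eq (by simp))

lemma norm_fst_comp_comp_inr_le_s16 (R : E × S →L[ℝ] E × S) :
    ‖((fst ℝ E S).comp R).comp (inr ℝ E S)‖ ≤ ‖R‖ :=
  opNorm_le_bound _ (norm_nonneg R) fun y =>
    (norm_fst_le (R (0, y))).trans ((R.le_opNorm _).trans_eq (by simp))

lemma norm_snd_comp_comp_inr_le (R : E × S →L[ℝ] E × S) :
    ‖((snd ℝ E S).comp R).comp (inr ℝ E S)‖ ≤ ‖R‖ :=
  opNorm_le_bound _ (norm_nonneg R) fun y =>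
    (norm_snd_le (R (0, y))).trans ((R.le_opNorm _).trans_eq (by simp))

variable {G : E × S → E × S} {z : E × S} {V : E × S →L[ℝ] E × S}

lemma HasFDerivAt.blockXX_eq (hG : HasFDerivAt G V z) :
    blockXX G z = ((fst ℝ E S).comp V).comp (inl ℝ E S) := by
  rw [blockXX, hG.fst.fderiv]

lemma HasFDerivAt.blockXY_eq (hG : HasFDerivAt G V z) :
    blockXY G z = ((fst ℝ E S).comp V).comp (inr ℝ E S) := by
  rw [blockXY, hG.fst.fderiv]

lemma HasFDerivAt.blockYY_eq (hG : HasFDerivAt G V z) :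
    blockYY G z = ((snd ℝ E S).comp V).comp (inr ℝ E S) := by
  rw [blockYY, hG.snd.fderiv]

variable {f : E × S → E × S} {h δ : ℝ}

lemma norm_blockXX_sub_le (hG : HasFDerivAt G V z) (hf : DifferentiableAt ℝ f z)
    (hV : ‖V - 1 - h • fderiv ℝ f z‖ ≤ δ) :
    ‖blockXX G z - (1 + h • blockXX f z)‖ ≤ δ := by
  refine le_trans (le_of_eq ?_) ((norm_fst_comp_comp_inl_le_s16 _).trans hV)
  rw [hG.blockXX_eq, hf.hasFDerivAt.blockXX_eq]
  congr 1
  ext x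
  simp [sub_sub]

lemma norm_blockXY_sub_le (hG : HasFDerivAt G V z) (hf : DifferentiableAt ℝ f z)
    (hV : ‖V - 1 - h • fderiv ℝ f z‖ ≤ δ) :
    ‖blockXY G z - h • blockXY f z‖ ≤ δ := by
  refine le_trans (le_of_eq ?_) ((norm_fst_comp_comp_inr_le_s16 _).trans hV)
  rw [hG.blockXY_eq, hf.hasFDerivAt.blockXY_eq]
  congr 1
  ext x
  simp

lemma norm_blockYY_sub_le (hG : HasFDerivAt G V z) (hf : DifferentiableAt ℝ f z)
    (hV : ‖V - 1 - h • fderiv ℝ f z‖ ≤ δ) :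
    ‖blockYY G z - (1 + h • blockYY f z)‖ ≤ δ := by
  refine le_trans (le_of_eq ?_) ((norm_snd_comp_comp_inr_le _).trans hV)
  rw [hG.blockYY_eq, hf.hasFDerivAt.blockYY_eq]
  congr 1
  ext x
  simp [sub_sub]

lemma norm_blockXY_le (hG : HasFDerivAt G V z) (hf : DifferentiableAt ℝ f z) (hh : 0 ≤ h)
    (hV : ‖V - 1 - h • fderiv ℝ f z‖ ≤ δ) :
    ‖blockXY G z‖ ≤ h * ‖blockXY f z‖ + δ := by
  have h1 := norm_blockXY_sub_le hG hf hV
  have h2 := norm_add_le (blockXY G z - h • blockXY f z) (h • blockXY f z)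
  rw [sub_add_cancel, norm_smul, Real.norm_of_nonneg hh] at h2
  linarith

end Blocks

/-- If the infinitesimal rate condition `μ⃗₂(M₁) < (j+1)·ξ⃗(M₂)` holds for the vector field,
then for all sufficiently small `h > 0` the rate condition `μ₂(h, M₁)/ξ(h, M₂)^{j+1} < 1`
holds for the time-`h` shift map, with `ξ(h, M₂) > 0`. -/
theorem time_shift_rate_conditions
    {u s : ℕ} (hu : 1 ≤ u) (hs : 1 ≤ s)
    (f : EuclideanSpace ℝ (Fin u) × EuclideanSpace ℝ (Fin s) →
      EuclideanSpace ℝ (Fin u) × EuclideanSpace ℝ (Fin s))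
    (hf : ContDiff ℝ 2 f)
    (h₀ : ℝ) (hh₀ : 0 < h₀)
    (D U : Set (EuclideanSpace ℝ (Fin u) × EuclideanSpace ℝ (Fin s)))
    (hD : IsCompact D) (hDne : D.Nonempty) (hU : IsOpen U) (hDU : D ⊆ U)
    (Φ : ℝ → EuclideanSpace ℝ (Fin u) × EuclideanSpace ℝ (Fin s) →
      EuclideanSpace ℝ (Fin u) × EuclideanSpace ℝ (Fin s))
    (hΦ0 : ∀ z ∈ U, Φ 0 z = z)
    (hΦ : ∀ z ∈ U, ∀ t ∈ Set.Icc (0 : ℝ) h₀,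
      HasDerivAt (fun τ => Φ τ z) (f (Φ t z)) t)
    (M₁ M₂ : ℝ) (hM₁ : 0 < M₁) (hM₂ : 0 < M₂) (j : ℕ)
    (hrate : (⨆ z : D, (rayleighMax (blockYY f (z : _)) + M₁ * ‖blockXY f (z : _)‖))
        < (j + 1 : ℝ) * (⨅ z : D, (rayleighMin (blockXX f (z : _)) - M₂ * ‖blockXY f (z : _)‖))) :
    ∃ h₁ ∈ Set.Ioc (0 : ℝ) h₀, ∀ h ∈ Set.Ioo (0 : ℝ) h₁,
      0 < (⨅ z : D, (minExp (blockXX (Φ h) (z : _)) - M₂ * ‖blockXY (Φ h) (z : _)‖)) ∧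
      (⨆ z : D, (‖blockYY (Φ h) (z : _)‖ + M₁ * ‖blockXY (Φ h) (z : _)‖))
          / (⨅ z : D, (minExp (blockXX (Φ h) (z : _)) - M₂ * ‖blockXY (Φ h) (z : _)‖)) ^ (j + 1)
        < 1 := by
  have : Nonempty (Fin u) := ⟨⟨0, hu⟩⟩
  have : Nonempty (Fin s) := ⟨⟨0, hs⟩⟩
  have : Nonempty D := hDne.to_subtype
  have hdiff : Differentiable ℝ f := hf.differentiable (by norm_num)
  obtain ⟨L, hL⟩ := hD.exists_bound_of_continuousOn
    (hf.continuous_fderiv (by norm_num)).continuousOn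
  have hXX : ∀ z : D, ‖blockXX f (z : _)‖ ≤ L := fun z => by
    rw [(hdiff z).hasFDerivAt.blockXX_eq]
    exact (norm_fst_comp_comp_inl_le_s16 _).trans (hL z z.2)
  have hXY : ∀ z : D, ‖blockXY f (z : _)‖ ≤ L := fun z => by
    rw [(hdiff z).hasFDerivAt.blockXY_eq]
    exact (norm_fst_comp_comp_inr_le_s16 _).trans (hL z z.2)
  have hYY : ∀ z : D, ‖blockYY f (z : _)‖ ≤ L := fun z => by
    rw [(hdiff z).hasFDerivAt.blockYY_eq]
    exact (norm_snd_comp_comp_inr_le _).trans (hL z z.2)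
  set μ := ⨆ z : D, (rayleighMax (blockYY f (z : _)) + M₁ * ‖blockXY f (z : _)‖) with hμ
  set ξ := ⨅ z : D, (rayleighMin (blockXX f (z : _)) - M₂ * ‖blockXY f (z : _)‖) with hξ
  have hleμ : ∀ z : D, rayleighMax (blockYY f (z : _)) + M₁ * ‖blockXY f (z : _)‖ ≤ μ := by
    refine le_ciSup ⟨L + M₁ * L, ?_⟩
    rintro _ ⟨z, rfl⟩
    exact add_le_add ((rayleighMax_le_norm _).trans (hYY z))
      (mul_le_mul_of_nonneg_left (hXY z) hM₁.le)
  have hξle : ∀ z : D, ξ ≤ rayleighMin (blockXX f (z : _)) - M₂ * ‖blockXY f (z : _)‖ := by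
    refine ciInf_le ⟨-L - M₂ * L, ?_⟩
    rintro _ ⟨z, rfl⟩
    exact sub_le_sub ((neg_le_neg (hXX z)).trans (neg_norm_le_rayleighMin _))
      (mul_le_mul_of_nonneg_left (hXY z) hM₂.le)
  obtain ⟨ε, hε, hεgap⟩ : ∃ ε > 0,
      μ + (2 + M₁) * ε < (j + 1 : ℝ) * (ξ - (1 + M₂) * ε) := by
    have hc : 0 < (2 + M₁) + (j + 1 : ℝ) * (1 + M₂) := by positivity
    refine ⟨((j + 1 : ℝ) * ξ - μ) / 2 / ((2 + M₁) + (j + 1 : ℝ) * (1 + M₂)),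
      div_pos (by linarith) hc, ?_⟩
    have h := div_mul_cancel₀ (((j + 1 : ℝ) * ξ - μ) / 2) hc.ne'
    linarith
  set a := ξ - (1 + M₂) * ε with ha
  set b := μ + (2 + M₁) * ε with hb
  obtain ⟨T, hT, hflow⟩ := exists_hasFDerivAt_flow_uniform (hf.of_le (by norm_num)) hh₀ hD hU hDU
    hΦ0 hΦ hε
  have hTpos := hT.1
  have hmin : 0 < min T (min (ε / (L ^ 2 + 1)) (1 / (|a| + 1))) := by positivity
  refine ⟨_, ⟨hmin, (min_le_left _ _).trans hT.2⟩, fun h hh => ?_⟩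
  have hh0 : 0 < h := hh.1
  have hhT : h ∈ Set.Icc 0 T := ⟨hh0.le, hh.2.le.trans (min_le_left _ _)⟩
  have hhL : h * L ^ 2 ≤ ε := by
    have h1 : h ≤ ε / (L ^ 2 + 1) :=
      hh.2.le.trans ((min_le_right _ _).trans (min_le_left _ _))
    rw [le_div_iff₀ (by positivity)] at h1
    linarith
  have hha : 0 < 1 + h * a := by
    have h1 : h < 1 / (|a| + 1) :=
      hh.2.trans_le ((min_le_right _ _).trans (min_le_right _ _))
    rw [lt_div_iff₀ (by positivity)] at h1
    nlinarith [neg_abs_le a]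
  have hlow : 1 + h * a ≤
      ⨅ z : D, (minExp (blockXX (Φ h) (z : _)) - M₂ * ‖blockXY (Φ h) (z : _)‖) := by
    refine le_ciInf fun z => ?_
    obtain ⟨V, hV, hVε⟩ := hflow h hhT z z.2
    have h1 := le_minExp_of_norm_sub_le _ _ hh0.le (norm_blockXX_sub_le hV (hdiff z) hVε)
    have h2 := mul_le_mul_of_nonneg_left (norm_blockXY_le hV (hdiff z) hh0.le hVε) hM₂.le
    have h3 := mul_le_mul_of_nonneg_left (hξle z) hh0.le
    rw [ha]
    linarith
  have hup : (⨆ z : D, (‖blockYY (Φ h) (z : _)‖ + M₁ * ‖blockXY (Φ h) (z : _)‖)) ≤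
      1 + h * b := by
    refine ciSup_le fun z => ?_
    obtain ⟨V, hV, hVε⟩ := hflow h hhT z z.2
    have h1 := norm_blockYY_sub_le hV (hdiff z) hVε
    have h2 := mul_le_mul_of_nonneg_left (norm_blockXY_le hV (hdiff z) hh0.le hVε) hM₁.le
    have h3 := mul_le_mul_of_nonneg_left (hleμ z) hh0.le
    have h4 := norm_one_add_smul_le (blockYY f (z : _)) hh0.le
    have h5 := norm_add_le (blockYY (Φ h) (z : _) - (1 + h • blockYY f (z : _)))
      (1 + h • blockYY f (z : _))
    rw [sub_add_cancel] at h5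
    have h6 : (h * ‖blockYY f (z : _)‖) ^ 2 ≤ h * ε := by
      have h7 : (h * ‖blockYY f (z : _)‖) ^ 2 ≤ (h * L) ^ 2 := by
        gcongr
        exact hYY z
      nlinarith
    rw [hb]
    linarith
  have hpos := hha.trans_le hlow
  refine ⟨hpos, ?_⟩
  rw [div_lt_one (pow_pos hpos _)]
  calc _ ≤ 1 + h * b := hup
    _ < 1 + ((j + 1 : ℕ) : ℝ) * (h * a) := by
      push_cast
      nlinarith [mul_lt_mul_of_pos_left hεgap hh0]
    _ ≤ (1 + h * a) ^ (j + 1) := one_add_mul_le_pow (by linarith) _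
    _ ≤ _ := pow_le_pow_left₀ hha.le hlow _
end
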